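/- arXiv:math/0508474 — 2 statements merged into one kernel-verified Lean document; each statement's English description precedes it below -/
import Mathlib

section
/- There exist universal constants σ₀ > 0 and C₀ > 0 such that for every σ < σ₀, every q > 0, and every s with σ^{1/8} ≤ s/q ≤ π − σ^{1/16}, setting P = γ(s), Q = γ(πq) = (2q,0,0), and Π₁(z;t) = z the vertical projection onto {t = 0}, one has Π₁( B(P, (1+σ) d(P,Q)) ∩ {t > 0} ) ⊆ { z ∈ ℂ : |z − 2q| ≤ C₀ q σ^{1/4} }. -/
noncomputable section

open MeasureTheory

/-- Points of the Heisenberg group `ℍ`, identified with `ℝ³ ≅ ℂ × ℝ`: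
`(x, y, t)` corresponds to `(z ; t)` with `z = x + iy`. -/
abbrev H : Type := ℝ × ℝ × ℝ

/-- The Heisenberg group law
`(x,y,t)·(x',y',t') = (x+x', y+y', t+t'+2(x'y − xy'))`. -/
def Hmul (p q : H) : H :=
  (p.1 + q.1, p.2.1 + q.2.1, p.2.2 + q.2.2 + 2 * (q.1 * p.2.1 - p.1 * q.2.1))

/-- The Heisenberg group inverse. -/
def Hinv (p : H) : H := (-p.1, -p.2.1, -p.2.2)

/-- The identity `O = (0,0,0)`. -/
def HO : H := (0, 0, 0)

/-- The control (Carnot–Carathéodory) distance: the infimum of the lengths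
`∫₀¹ √(a(s)² + b(s)²) ds` of horizontal Lipschitz curves `γ` joining `P` to `Q`,
i.e. curves satisfying a.e. `γ' = a·X(γ) + b·Y(γ)` where `X = ∂ₓ + 2y∂_t` and
`Y = ∂_y − 2x∂_t`. -/
def dH (P Q : H) : ℝ :=
  sInf { L : ℝ | ∃ (γ : ℝ → H) (a b : ℝ → ℝ) (K : NNReal),
    LipschitzWith K γ ∧ γ 0 = P ∧ γ 1 = Q ∧
    (∀ᵐ s ∂volume, s ∈ Set.Icc (0:ℝ) 1 →
      HasDerivAt γ (a s, b s, 2 * (γ s).2.1 * a s - 2 * (γ s).1 * b s) s) ∧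
    IntervalIntegrable (fun s => Real.sqrt (a s ^ 2 + b s ^ 2)) volume 0 1 ∧
    L = ∫ s in (0:ℝ)..1, Real.sqrt (a s ^ 2 + b s ^ 2) }

/-- `γ : ℝ → ℍ` is a `(1+ε)`-quasigeodesic. -/
def IsQuasiGeodesic (ε : ℝ) (γ : ℝ → H) : Prop :=
  ∀ s s' : ℝ, (1 + ε)⁻¹ * |s - s'| ≤ dH (γ s) (γ s') ∧
    dH (γ s) (γ s') ≤ (1 + ε) * |s - s'|

/-- `f : ℍ → ℍ` is `(1+ε)`-biLipschitz for the control distance. -/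
def IsBiLip (ε : ℝ) (f : H → H) : Prop :=
  ∀ P Q : H, (1 + ε)⁻¹ * dH P Q ≤ dH (f P) (f Q) ∧ dH (f P) (f Q) ≤ (1 + ε) * dH P Q

/-- `(a,b)` is the horizontal speed of `γ`: a.e. `γ'(s) = a(s)X(γ(s)) + b(s)Y(γ(s))`. -/
def HasHorizSpeed (γ : ℝ → H) (a b : ℝ → ℝ) : Prop :=
  ∀ᵐ s ∂volume, HasDerivAt γ (a s, b s, 2 * (γ s).2.1 * a s - 2 * (γ s).1 * b s) s

/-- The unit-speed geodesic of total lifetime `2πq` with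
`γ(0) = (0,0,−2πq²)` and `γ(πq) = (2q,0,0)`. -/
def geoq (q s : ℝ) : H :=
  (q * (1 - Real.cos (s / q)), q * Real.sin (s / q),
    2 * q ^ 2 * (s / q - Real.pi - Real.sin (s / q)))


abbrev ACI (f : ℝ → ℝ) (a b : ℝ) : Prop := AbsolutelyContinuousOnInterval f a b

theorem aci_comp_lip {f G : ℝ → ℝ} {a b : ℝ} {S : Set ℝ} {K : NNReal}
    (hf : ACI f a b) (hG : LipschitzOnWith K G S) (hm : ∀ s ∈ Set.uIcc a b, f s ∈ S) :
    ACI (fun s => G (f s)) a b := by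
  rw [ACI, absolutelyContinuousOnInterval_iff] at hf ⊢
  intro ε hε
  obtain ⟨δ, hδ, h⟩ := hf (ε / (K + 1)) (by positivity)
  refine ⟨δ, hδ, fun E hE hsum => ?_⟩
  have h1 := h E hE hsum
  have h2 : ∑ i ∈ Finset.range E.1, dist (G (f (E.2 i).1)) (G (f (E.2 i).2)) ≤
      ∑ i ∈ Finset.range E.1, K * dist (f (E.2 i).1) (f (E.2 i).2) := by
    refine Finset.sum_le_sum fun i hi => ?_
    have := hE.1 i hi
    exact hG.dist_le_mul _ (hm _ this.1) _ (hm _ this.2)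
  rw [← Finset.mul_sum] at h2
  refine lt_of_le_of_lt h2 ?_
  have h0 : 0 ≤ ∑ i ∈ Finset.range E.1, dist (f (E.2 i).1) (f (E.2 i).2) :=
    Finset.sum_nonneg fun _ _ => dist_nonneg
  have hK : (0:ℝ) ≤ K := K.2
  rw [lt_div_iff₀ (by positivity)] at h1
  nlinarith

theorem aci_comp_c1 {f G : ℝ → ℝ} {a b m : ℝ}
    (hf : ACI f a b) (hG : ContDiffOn ℝ 1 G (Set.Ici m)) (hm : ∀ s ∈ Set.uIcc a b, m ≤ f s) :
    ACI (fun s => G (f s)) a b := by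
  obtain ⟨B, hB⟩ := hf.exists_bound
  obtain ⟨K, hK⟩ := (hG.mono (fun z (hz : z ∈ Set.Icc m B) => hz.1)).exists_lipschitzOnWith
    one_ne_zero (convex_Icc m B) isCompact_Icc
  exact aci_comp_lip hf hK fun s hs => ⟨hm s hs, le_trans (le_abs_self _) (hB s hs)⟩

theorem aci_inv {f : ℝ → ℝ} {a b : ℝ} (hf : ACI f a b) (hp : ∀ s ∈ Set.uIcc a b, 0 < f s) :
    ACI (fun s => (f s)⁻¹) a b := by
  obtain ⟨s0, hs0, hmin⟩ := isCompact_uIcc.exists_isMinOn Set.nonempty_uIcc hf.continuousOn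
  refine aci_comp_c1 (m := f s0) hf ?_ (fun s hs => hmin hs)
  exact contDiffOn_id.inv fun x hx => (lt_of_lt_of_le (hp s0 hs0) hx).ne'

theorem aci_sqrt {f : ℝ → ℝ} {a b : ℝ} (hf : ACI f a b) (hp : ∀ s ∈ Set.uIcc a b, 0 < f s) :
    ACI (fun s => Real.sqrt (f s)) a b := by
  obtain ⟨s0, hs0, hmin⟩ := isCompact_uIcc.exists_isMinOn Set.nonempty_uIcc hf.continuousOn
  refine aci_comp_c1 (m := f s0) hf ?_ (fun s hs => hmin hs)
  exact contDiffOn_id.sqrt fun x hx => (lt_of_lt_of_le (hp s0 hs0) hx).ne'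

theorem aci_const (c a b : ℝ) : ACI (fun _ => c) a b :=
  ((LipschitzWith.const c).lipschitzOnWith (s := Set.uIcc a b)).absolutelyContinuousOnInterval

theorem aci_sin {f : ℝ → ℝ} {a b : ℝ} (hf : ACI f a b) : ACI (fun s => Real.sin (f s)) a b := by
  obtain ⟨B, hB⟩ := hf.exists_bound
  exact aci_comp_c1 (m := -B) hf Real.contDiff_sin.contDiffOn
    fun s hs => (abs_le.1 (hB s hs)).1

theorem aci_cos {f : ℝ → ℝ} {a b : ℝ} (hf : ACI f a b) : ACI (fun s => Real.cos (f s)) a b := by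
  obtain ⟨B, hB⟩ := hf.exists_bound
  exact aci_comp_c1 (m := -B) hf Real.contDiff_cos.contDiffOn
    fun s hs => (abs_le.1 (hB s hs)).1

theorem aci_mono {f : ℝ → ℝ} {a b : ℝ} (hf : ACI f a b) (hab : a ≤ b)
    (hd : ∀ᵐ s ∂volume, s ∈ Set.Icc a b → ∃ f', HasDerivAt f f' s ∧ 0 ≤ f') : f a ≤ f b := by
  have h := hf.integral_deriv_eq_sub
  have : 0 ≤ ∫ x in a..b, deriv f x := by
    apply intervalIntegral.integral_nonneg_of_ae_restrict hab
    rw [Filter.EventuallyLE, ae_restrict_iff' measurableSet_Icc]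
    filter_upwards [hd] with s hs hm
    obtain ⟨f', h1, h2⟩ := hs hm
    rw [h1.deriv]; exact h2
  linarith

/-- existence of the angle -/
theorem Phi_ex (x : ℝ) : ∃ p : ℝ, 0 ≤ p ∧ p < Real.pi / 2 ∧ p = max x 0 * Real.cos p := by
  have hx : 0 ≤ max x 0 := le_max_right _ _
  have hpi := Real.pi_pos
  have h := intermediate_value_Icc (a := 0) (b := Real.pi / 2) (by positivity)
    (f := fun p => p - max x 0 * Real.cos p) (by fun_prop)
  obtain ⟨p, hp, hp2⟩ := h (show (0:ℝ) ∈ _ by simp; positivity)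
  refine ⟨p, hp.1, lt_of_le_of_ne hp.2 ?_, by simp only at hp2; linarith⟩
  rintro rfl
  simp at hp2

def Phi (x : ℝ) : ℝ := Classical.choose (Phi_ex x)

theorem Phi_nonneg (x : ℝ) : 0 ≤ Phi x := (Classical.choose_spec (Phi_ex x)).1
theorem Phi_lt (x : ℝ) : Phi x < Real.pi / 2 := (Classical.choose_spec (Phi_ex x)).2.1
theorem Phi_eq {x : ℝ} (hx : 0 ≤ x) : Phi x = x * Real.cos (Phi x) := by
  have h : Phi x = max x 0 * Real.cos (Phi x) := (Classical.choose_spec (Phi_ex x)).2.2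
  have h2 := max_eq_left hx
  calc Phi x = max x 0 * Real.cos (Phi x) := h
    _ = x * Real.cos (Phi x) := by rw [h2]
theorem cos_Phi_pos (x : ℝ) : 0 < Real.cos (Phi x) :=
  Real.cos_pos_of_mem_Ioo ⟨by linarith [Phi_nonneg x, Real.pi_pos], Phi_lt x⟩

theorem ang_lip {x y p r : ℝ} (hy : 0 ≤ y) (hp : 0 ≤ p) (hp2 : p < Real.pi / 2)
    (hr : 0 ≤ r) (e1 : p = x * Real.cos p) (e2 : r = y * Real.cos r) :
    p - r ≤ |x - y| := by
  rcases le_total p r with h | h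
  · linarith [abs_nonneg (x - y)]
  · have h1 : Real.cos p ≤ Real.cos r :=
      Real.cos_le_cos_of_nonneg_of_le_pi hr (by linarith [Real.pi_pos]) h
    have h0 : 0 ≤ Real.cos p := Real.cos_nonneg_of_mem_Icc ⟨by linarith [Real.pi_pos], hp2.le⟩
    have h2 := Real.cos_le_one p
    have h3 : (x - y) * Real.cos p ≤ |x - y| := by
      nlinarith [le_abs_self (x - y), abs_nonneg (x - y)]
    nlinarith [mul_nonneg hy (sub_nonneg.2 h1)]

theorem Phi_lip : LipschitzOnWith 1 Phi (Set.Ici 0) := by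
  refine LipschitzOnWith.of_dist_le_mul fun x hx y hy => ?_
  simp only [NNReal.coe_one, one_mul, Real.dist_eq]
  rw [abs_sub_le_iff]
  refine ⟨ang_lip hy (Phi_nonneg x) (Phi_lt x) (Phi_nonneg y) (Phi_eq hx) (Phi_eq hy), ?_⟩
  rw [abs_sub_comm]
  exact ang_lip hx (Phi_nonneg y) (Phi_lt y) (Phi_nonneg x) (Phi_eq hy) (Phi_eq hx)

theorem Phi_unique {x p : ℝ} (hx : 0 ≤ x) (hp : 0 ≤ p) (hp2 : p < Real.pi / 2)
    (e1 : p = x * Real.cos p) : Phi x = p := by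
  apply le_antisymm
  · have := ang_lip hx (Phi_nonneg x) (Phi_lt x) hp (Phi_eq hx) e1
    simp at this; linarith
  · have := ang_lip hx hp hp2 (Phi_nonneg x) e1 (Phi_eq hx)
    simp at this; linarith

theorem one_le_CS {p : ℝ} (hp : 0 ≤ p) (hp2 : p ≤ Real.pi / 2) :
    1 ≤ Real.cos p + p * Real.sin p := by
  have hs : Real.sin p ≤ p := Real.sin_le hp
  have hs0 : 0 ≤ Real.sin p := Real.sin_nonneg_of_nonneg_of_le_pi hp (by linarith)
  have hc0 : 0 ≤ Real.cos p := Real.cos_nonneg_of_mem_Icc ⟨by linarith [Real.pi_pos], hp2⟩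
  nlinarith [Real.sin_sq_add_cos_sq p, Real.cos_le_one p]

theorem Phi_deriv {x : ℝ} (hx : 0 < x) :
    HasDerivAt Phi (Real.cos (Phi x) ^ 2 /
      (Real.cos (Phi x) + Phi x * Real.sin (Phi x))) x := by
  have hc := cos_Phi_pos x
  have h1 := one_le_CS (Phi_nonneg x) (Phi_lt x).le
  have hg : HasDerivAt (fun p => p / Real.cos p)
      ((Real.cos (Phi x) + Phi x * Real.sin (Phi x)) / Real.cos (Phi x) ^ 2) (Phi x) := by
    have := (hasDerivAt_id (Phi x)).div (Real.hasDerivAt_cos (Phi x)) hc.ne'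
    exact this.congr_deriv (by simp)
  have hcont : ContinuousAt Phi x := Phi_lip.continuousOn.continuousAt (Ici_mem_nhds hx)
  have := HasDerivAt.of_local_left_inverse hcont hg (by positivity) (by
    filter_upwards [Ici_mem_nhds hx] with y hy
    rw [div_eq_iff (cos_Phi_pos y).ne']
    exact Phi_eq hy)
  simpa using this

def rho (d : ℝ) (x y : ℝ → ℝ) (s : ℝ) : ℝ := Real.sqrt (x s ^ 2 + y s ^ 2 + d)
def ang (d : ℝ) (x y l : ℝ → ℝ) (s : ℝ) : ℝ := Phi (l s * (rho d x y s)⁻¹)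
def tng (d : ℝ) (x y l : ℝ → ℝ) (s : ℝ) : ℝ :=
  Real.sin (ang d x y l s) * (Real.cos (ang d x y l s))⁻¹
def Mf (d : ℝ) (x y t l : ℝ → ℝ) (s : ℝ) : ℝ :=
  t s + (x s ^ 2 + y s ^ 2 + d) *
    (ang d x y l s * ((Real.cos (ang d x y l s))⁻¹ * (Real.cos (ang d x y l s))⁻¹) + tng d x y l s)

theorem ang_rel {d : ℝ} {x y l : ℝ → ℝ} {s : ℝ} (hr : 0 < rho d x y s) (hl : 0 ≤ l s) :
    ang d x y l s * rho d x y s = l s * Real.cos (ang d x y l s) := by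
  have : ang d x y l s = l s * (rho d x y s)⁻¹ * Real.cos (ang d x y l s) :=
    Phi_eq (by positivity)
  have h2 := hr.ne'
  calc ang d x y l s * rho d x y s
      = (l s * (rho d x y s)⁻¹ * Real.cos (ang d x y l s)) * rho d x y s := by rw [← this]
    _ = _ := by field_simp

section der
variable {d : ℝ} {x y t l : ℝ → ℝ} {s a b k : ℝ}

theorem rho_sq (hr : 0 < rho d x y s) : rho d x y s ^ 2 = x s ^ 2 + y s ^ 2 + d :=
  Real.sq_sqrt (Real.sqrt_pos.1 hr).le

theorem rho_deriv (hr : 0 < rho d x y s) (hx : HasDerivAt x a s) (hy : HasDerivAt y b s) :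
    HasDerivAt (rho d x y) ((x s * a + y s * b) / rho d x y s) s := by
  have h1 : HasDerivAt (fun s => x s ^ 2 + y s ^ 2 + d) (2 * x s * a + 2 * y s * b) s := by
    have := ((hx.pow 2).add (hy.pow 2)).add_const d
    exact this.congr_deriv (by simp)
  have := h1.sqrt (Real.sqrt_pos.1 hr).ne'
  refine HasDerivAt.congr_deriv (f := rho d x y) this ?_
  have : Real.sqrt (x s ^ 2 + y s ^ 2 + d) = rho d x y s := rfl
  rw [this]; field_simp

theorem ang_deriv (hr : 0 < rho d x y s) (hl0 : 0 < l s) (hx : HasDerivAt x a s)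
    (hy : HasDerivAt y b s) (hl : HasDerivAt l (-k) s) :
    HasDerivAt (ang d x y l)
      (-(Real.cos (ang d x y l s) / rho d x y s) *
        (Real.cos (ang d x y l s) * k +
          ang d x y l s * ((x s * a + y s * b) / rho d x y s)) /
        (Real.cos (ang d x y l s) + ang d x y l s * Real.sin (ang d x y l s))) s := by
  have h1 := (hl.mul ((rho_deriv hr hx hy).inv hr.ne'))
  have h2 : HasDerivAt Phi _ (l s * (rho d x y s)⁻¹) := Phi_deriv (by positivity)
  have h3 := h2.comp s h1
  have h4 := one_le_CS (Phi_nonneg (l s * (rho d x y s)⁻¹)) (Phi_lt _).le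
  have h5 := ang_rel hr hl0.le
  change HasDerivAt (ang d x y l) (Real.cos (ang d x y l s) ^ 2 /
      (Real.cos (ang d x y l s) + ang d x y l s * Real.sin (ang d x y l s)) * _) s at h3
  change 1 ≤ Real.cos (ang d x y l s) + ang d x y l s * Real.sin (ang d x y l s) at h4
  refine h3.congr_deriv ?_
  simp only [Pi.inv_apply]
  generalize ang d x y l s = p at *
  generalize rho d x y s = r at *
  generalize hR : (x s * a + y s * b) / r = R
  have h6 : 0 < Real.cos p + p * Real.sin p := by linarith
  field_simp
  linear_combination (R * Real.cos p) * h5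

theorem cosang_pos : 0 < Real.cos (ang d x y l s) := cos_Phi_pos _

theorem M_deriv (hr : 0 < rho d x y s) (hl0 : 0 < l s) (hx : HasDerivAt x a s)
    (hy : HasDerivAt y b s) (hl : HasDerivAt l (-k) s)
    (ht : HasDerivAt t (2 * y s * a - 2 * x s * b) s) :
    HasDerivAt (Mf d x y t l)
      (2 * (y s * a - x s * b) + 2 * (Real.sin (ang d x y l s) * (x s * a + y s * b)
        - rho d x y s * k) / Real.cos (ang d x y l s)) s := by
  have h1 : HasDerivAt (fun s => x s ^ 2 + y s ^ 2 + d) (2 * x s * a + 2 * y s * b) s := by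
    have := ((hx.pow 2).add (hy.pow 2)).add_const d
    exact this.congr_deriv (by simp)
  have hp := ang_deriv hr hl0 hx hy hl
  have hc := hp.cos.inv cosang_pos.ne'
  have hs := hp.sin
  have hh := ht.add (h1.mul ((hp.mul (hc.mul hc)).add (hs.mul hc)))
  have h4 := one_le_CS (Phi_nonneg (l s * (rho d x y s)⁻¹)) (Phi_lt _).le
  change 1 ≤ Real.cos (ang d x y l s) + ang d x y l s * Real.sin (ang d x y l s) at h4
  have hC : 0 < Real.cos (ang d x y l s) := cosang_pos
  have h5 := rho_sq hr
  have h7 := Real.sin_sq_add_cos_sq (ang d x y l s)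
  refine HasDerivAt.congr_deriv (f := Mf d x y t l) hh ?_
  simp only [Pi.inv_apply, Pi.mul_apply, Pi.add_apply]
  rw [← h5]
  generalize ang d x y l s = p at *
  generalize rho d x y s = r at *
  have h6 : 0 < Real.cos p + p * Real.sin p := by linarith
  generalize Real.cos p = C at *
  generalize Real.sin p = S at *
  have h8 : (2 * x s * a + 2 * y s * b) = 2 * (x s * a + y s * b) := by ring
  rw [h8]
  generalize (x s * a + y s * b) = R at *
  have hS : S ^ 2 = 1 - C ^ 2 := by linarith
  field_simp
  ring_nf
  simp only [hS]
  ring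

theorem tng_deriv (hr : 0 < rho d x y s) (hl0 : 0 < l s) (hx : HasDerivAt x a s)
    (hy : HasDerivAt y b s) (hl : HasDerivAt l (-k) s) :
    HasDerivAt (tng d x y l)
      (-(1 / (Real.cos (ang d x y l s) * rho d x y s)) *
        (Real.cos (ang d x y l s) * k +
          ang d x y l s * ((x s * a + y s * b) / rho d x y s)) /
        (Real.cos (ang d x y l s) + ang d x y l s * Real.sin (ang d x y l s))) s := by
  have hp := ang_deriv hr hl0 hx hy hl
  have hh := hp.sin.mul (hp.cos.inv cosang_pos.ne')
  have h4 := one_le_CS (Phi_nonneg (l s * (rho d x y s)⁻¹)) (Phi_lt _).le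
  change 1 ≤ Real.cos (ang d x y l s) + ang d x y l s * Real.sin (ang d x y l s) at h4
  have hC : 0 < Real.cos (ang d x y l s) := cosang_pos
  have h7 := Real.sin_sq_add_cos_sq (ang d x y l s)
  refine HasDerivAt.congr_deriv (f := tng d x y l) hh ?_
  simp only [Pi.inv_apply]
  generalize ang d x y l s = p at *
  generalize rho d x y s = r at *
  have h6 : 0 < Real.cos p + p * Real.sin p := by linarith
  generalize Real.cos p = C at *
  generalize Real.sin p = S at *
  generalize (x s * a + y s * b) = R at *
  have hS : S ^ 2 = 1 - C ^ 2 := by linarith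
  field_simp
  simp only [hS]
  ring

end der

/-- rough inequality -/
theorem key_rough {x y d r a b u k S C : ℝ} (hr : 0 < r) (hd : 0 ≤ d) (hr2 : r ^ 2 = x ^ 2 + y ^ 2 + d)
    (hu : 0 ≤ u) (hu2 : u ^ 2 = a ^ 2 + b ^ 2) (hC : 0 < C) (hCS : S ^ 2 + C ^ 2 = 1)
    (hm : r ≤ 10 * C) (hk : 0 ≤ k) {σ : ℝ} (hσ : 0 ≤ σ) (huk : u = (1 + σ) * k) :
    2 * (y * a - x * b) + 2 * (S * (x * a + y * b) - r * k) / C ≤ 20 * σ * k := by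
  have h1 : C * (y * a - x * b) + S * (x * a + y * b) ≤ r * u := by
    apply le_of_sq_le_sq ?_ (by positivity)
    have : (r * u) ^ 2 = (x ^ 2 + y ^ 2 + d) * (a ^ 2 + b ^ 2) := by rw [mul_pow, hr2, hu2]
    rw [this]
    have e : (C * (y * a - x * b) + S * (x * a + y * b)) ^ 2
      = (S ^ 2 + C ^ 2) * ((x ^ 2 + y ^ 2) * (a ^ 2 + b ^ 2))
        - (S * (y * a - x * b) - C * (x * a + y * b)) ^ 2 := by ring
    rw [e, hCS]
    nlinarith [sq_nonneg (S * (y * a - x * b) - C * (x * a + y * b)), mul_nonneg hd (add_nonneg (sq_nonneg a) (sq_nonneg b))]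
  have e : 2 * (y * a - x * b) + 2 * (S * (x * a + y * b) - r * k) / C
     = 2 * (C * (y * a - x * b) + S * (x * a + y * b) - r * k) / C := by field_simp; ring
  rw [e, div_le_iff₀ hC]
  have : r * u - r * k = r * σ * k := by rw [huk]; ring
  have h3 : r * (σ * k) ≤ 10 * C * (σ * k) := mul_le_mul_of_nonneg_right hm (by positivity)
  nlinarith

set_option maxHeartbeats 2000000 in
theorem key_fine {x y r a b u k S C p η : ℝ} (hr : 0 < r) (hr2 : r ^ 2 = x ^ 2 + y ^ 2)
    (hu : 0 ≤ u) (hu2 : u ^ 2 = a ^ 2 + b ^ 2) (hC : 0 < C) (hC1 : C ≤ 1)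
    (hS : 0 ≤ S) (hS1 : S ≤ 1) (hCS : S ^ 2 + C ^ 2 = 1)
    (hm : r ≤ 10 * C) (hm1 : C ≤ r) (hk : 0 ≤ k) (hη : 0 < η) (hη1 : η ≤ 1)
    (huk : u = (1 + η ^ 2) * k) (hp : 0 ≤ p) (hp2 : p ≤ 2) (hD : 1 ≤ C + p * S) (hSp : p * C ≤ S) :
    let B := 12 * η * k - (2 * (y * a - x * b) + 2 * (S * (x * a + y * b) - r * k) / C) / (2 * η)
    (0 ≤ B) ∧
    (-(C / r) * (C * k + p * ((x * a + y * b) / r)) / (C + p * S) ≤ 2 * B) ∧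
    (|a + (b * (S * C⁻¹) + y * (-(1 / (C * r)) * (C * k + p * ((x * a + y * b) / r)) / (C + p * S)))|
      ≤ 4 * B / C) ∧
    (|b - (a * (S * C⁻¹) + x * (-(1 / (C * r)) * (C * k + p * ((x * a + y * b) / r)) / (C + p * S)))|
      ≤ 4 * B / C) := by
  intro B
  obtain ⟨X, hX⟩ : ∃ X, x = r * X := ⟨x / r, by field_simp⟩
  obtain ⟨Y, hY⟩ : ∃ Y, y = r * Y := ⟨y / r, by field_simp⟩
  have hXY : X ^ 2 + Y ^ 2 = 1 := by
    have : r ^ 2 * (X ^ 2 + Y ^ 2) = r ^ 2 * 1 := by rw [mul_one]; nth_rewrite 2 [hr2]; rw [hX, hY]; ring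
    exact mul_left_cancel₀ (by positivity) this
  obtain ⟨e1, he1⟩ : ∃ e1, X * a + Y * b = e1 + k * S := ⟨X * a + Y * b - k * S, by ring⟩
  obtain ⟨e2, he2⟩ : ∃ e2, Y * a - X * b = e2 + k * C := ⟨Y * a - X * b - k * C, by ring⟩
  have ha : a = X * (e1 + k * S) + Y * (e2 + k * C) := by
    rw [← he1, ← he2]; linear_combination (-a) * hXY
  have hb : b = Y * (e1 + k * S) - X * (e2 + k * C) := by
    rw [← he1, ← he2]; linear_combination (-b) * hXY
  have hR : x * a + y * b = r * (e1 + k * S) := by rw [hX, hY, ← he1]; ring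
  have hΩ : y * a - x * b = r * (e2 + k * C) := by rw [hX, hY, ← he2]; ring
  have hRr : (x * a + y * b) / r = e1 + k * S := by rw [hR]; field_simp
  set q := S * (e1 + k * S) + C * (e2 + k * C) with hq
  have huu : u ^ 2 = (e1 + k * S) ^ 2 + (e2 + k * C) ^ 2 := by
    rw [hu2, ← he1, ← he2]; linear_combination (-(a ^ 2 + b ^ 2)) * hXY
  have hqu : q ≤ u := by
    apply le_of_sq_le_sq ?_ hu
    rw [huu, hq]
    have e : (S * (e1 + k * S) + C * (e2 + k * C)) ^ 2 =
      (S ^ 2 + C ^ 2) * ((e1 + k * S) ^ 2 + (e2 + k * C) ^ 2) -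
        (C * (e1 + k * S) - S * (e2 + k * C)) ^ 2 := by ring
    rw [e, hCS]
    linarith [sq_nonneg (C * (e1 + k * S) - S * (e2 + k * C))]
  have hB : B = 12 * η * k + (r / C) * (k - q) / η := by
    simp only [B]
    rw [hR, hΩ, hq]
    field_simp
    ring
  have hm' : 1 ≤ r / C := by rw [le_div_iff₀ hC]; linarith
  have hm'' : r / C ≤ 10 := by rw [div_le_iff₀ hC]; linarith
  have hB2 : 2 * η * k + (u - q) / η ≤ B := by
    have h1 : (r / C) * (k - q) = (r / C) * (u - q) - (r / C) * (η ^ 2 * k) := by rw [huk]; ring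
    have h2 : (u - q) - 10 * (η ^ 2 * k) ≤ (r / C) * (k - q) := by
      rw [h1]
      have h5 := mul_nonneg (sub_nonneg.2 hm') (sub_nonneg.2 hqu)
      have h6 := mul_nonneg (sub_nonneg.2 hm'') (show 0 ≤ η ^ 2 * k by positivity)
      linarith
    rw [hB]
    have h3 : ((u - q) - 10 * (η ^ 2 * k)) / η ≤ (r / C) * (k - q) / η := by gcongr
    have h4 : ((u - q) - 10 * (η ^ 2 * k)) / η = (u - q) / η - 10 * η * k := by field_simp
    linarith
  have hg : 0 ≤ (u - q) / η := div_nonneg (by linarith) hη.le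
  have hB0 : 0 ≤ B := le_trans (by positivity) hB2
  have hee : e1 ^ 2 + e2 ^ 2 ≤ B ^ 2 := by
    have h1 : e1 ^ 2 + e2 ^ 2 = (u - k) ^ 2 + 2 * k * (u - q) := by
      rw [hq]; linear_combination (-1) * huu + (k^2) * hCS
    have h2 : u - k = η ^ 2 * k := by rw [huk]; ring
    have h3 : (2 * η * k + (u - q) / η) ^ 2 ≤ B ^ 2 := by gcongr
    have h4 : (2 * η * k + (u - q) / η) ^ 2 =
      4 * (η * k) ^ 2 + 4 * k * (u - q) + ((u - q) / η) ^ 2 := by field_simp; ring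
    have h5 : (η ^ 2 * k) ^ 2 ≤ (η * k) ^ 2 := by
      have : η ^ 2 * k ≤ η * k := mul_le_mul_of_nonneg_right (by nlinarith only [hη, hη1]) hk
      gcongr
    rw [h1, h2]
    have h6 := sq_nonneg ((u - q) / η)
    have h7 := mul_nonneg hk (sub_nonneg.2 hqu)
    have h8 := sq_nonneg (η * k)
    linarith
  have hE1 : |e1| ≤ B := abs_le_of_sq_le_sq (by linarith [sq_nonneg e2]) hB0
  have hE2 : |e2| ≤ B := abs_le_of_sq_le_sq (by linarith [sq_nonneg e1]) hB0
  clear_value B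
  have hD0 : 0 < C + p * S := by linarith
  have hXa : |X| ≤ 1 := by rw [← sq_le_one_iff_abs_le_one]; linarith [sq_nonneg Y]
  have hYa : |Y| ≤ 1 := by rw [← sq_le_one_iff_abs_le_one]; linarith [sq_nonneg X]
  have hrc : |e1 - e2 * S / C| ≤ 2 * B / C := by
    have h1 : |e1 - e2 * S / C| ≤ |e1| + |e2 * S / C| := abs_sub _ _
    have h2 : |e2 * S / C| ≤ B / C := by
      rw [abs_div, abs_mul, abs_of_pos hC, abs_of_nonneg hS]
      gcongr
      exact le_trans (mul_le_mul hE2 hS1 hS hB0) (by linarith)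
    have h3 : B ≤ B / C := by rw [le_div_iff₀ hC]; exact mul_le_of_le_one_right hB0 hC1
    have h4 : 2 * B / C = B / C + B / C := by ring
    linarith
  have hcc : |e2 + e1 * ((S - p * C) / (C + p * S))| ≤ 2 * B / C := by
    have h1 := abs_add_le e2 (e1 * ((S - p * C) / (C + p * S)))
    have h2 : |e1 * ((S - p * C) / (C + p * S))| ≤ B := by
      have h5 : 0 ≤ (S - p * C) / (C + p * S) := div_nonneg (by linarith) hD0.le
      have h6 : (S - p * C) / (C + p * S) ≤ 1 := by
        rw [div_le_one hD0]; linarith [mul_nonneg hp hC.le]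
      rw [abs_mul, abs_of_nonneg h5]
      exact le_trans (mul_le_mul hE1 h6 h5 hB0) (by linarith)
    have h3 : B ≤ B / C := by rw [le_div_iff₀ hC]; exact mul_le_of_le_one_right hB0 hC1
    have h4 : 2 * B / C = B / C + B / C := by ring
    linarith
  have hS2 : S ^ 2 = 1 - C ^ 2 := by linarith
  rw [hRr]
  refine ⟨hB0, ?_, ?_, ?_⟩
  · have e : -(C / r) * (C * k + p * (e1 + k * S)) / (C + p * S)
      = -(C / r) * k + (C / r) * (p * (-e1) / (C + p * S)) := by field_simp; ring
    rw [e]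
    have h0 : 0 ≤ C / r := by positivity
    have h1 : C / r ≤ 1 := by rw [div_le_one hr]; exact hm1
    have h2 : p * (-e1) / (C + p * S) ≤ 2 * B := by
      rw [div_le_iff₀ hD0]
      have : p * (-e1) ≤ 2 * B :=
        le_trans (mul_le_mul_of_nonneg_left (show -e1 ≤ B by linarith [neg_abs_le e1]) hp)
          (mul_le_mul_of_nonneg_right hp2 hB0)
      have h9 : 2 * B * 1 ≤ 2 * B * (C + p * S) := mul_le_mul_of_nonneg_left hD (by linarith)
      linarith
    have h7 := mul_nonneg h0 hk
    have h8 : (C / r) * (p * (-e1) / (C + p * S)) ≤ (C / r) * (2 * B) :=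
      mul_le_mul_of_nonneg_left h2 h0
    have h10 : (C / r) * (2 * B) ≤ 1 * (2 * B) := mul_le_mul_of_nonneg_right h1 (by linarith)
    linarith
  · have e : a + (b * (S * C⁻¹) + y * (-(1 / (C * r)) * (C * k + p * (e1 + k * S)) / (C + p * S)))
      = X * (e1 - e2 * S / C) + Y * (e2 + e1 * ((S - p * C) / (C + p * S))) := by
      rw [ha, hb, hY]; field_simp; ring_nf; simp only [show S ^ 3 = S * S ^ 2 by ring, hS2]; ring
    rw [e]
    have h1 := abs_add_le (X * (e1 - e2 * S / C)) (Y * (e2 + e1 * ((S - p * C) / (C + p * S))))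
    rw [abs_mul, abs_mul] at h1
    have h4 : 4 * B / C = 2 * B / C + 2 * B / C := by ring
    have h5 := mul_le_mul hXa hrc (abs_nonneg _) zero_le_one
    have h6 := mul_le_mul hYa hcc (abs_nonneg _) zero_le_one
    linarith
  · have e : b - (a * (S * C⁻¹) + x * (-(1 / (C * r)) * (C * k + p * (e1 + k * S)) / (C + p * S)))
      = Y * (e1 - e2 * S / C) + (-X) * (e2 + e1 * ((S - p * C) / (C + p * S))) := by
      rw [ha, hb, hX]; field_simp; ring_nf; simp only [show S ^ 3 = S * S ^ 2 by ring, hS2]; ring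
    rw [e]
    have h1 := abs_add_le (Y * (e1 - e2 * S / C)) ((-X) * (e2 + e1 * ((S - p * C) / (C + p * S))))
    rw [abs_mul, abs_mul, abs_neg] at h1
    have h4 : 4 * B / C = 2 * B / C + 2 * B / C := by ring
    have h5 := mul_le_mul hXa hcc (abs_nonneg _) zero_le_one
    have h6 := mul_le_mul hYa hrc (abs_nonneg _) zero_le_one
    linarith

structure Crv (x y t l a b k : ℝ → ℝ) (σ : ℝ) : Prop where
  acx : ACI x 0 1
  acy : ACI y 0 1
  act : ACI t 0 1
  acl : ACI l 0 1
  der : ∀ᵐ s ∂volume, s ∈ Set.Icc (0:ℝ) 1 → HasDerivAt x (a s) s ∧ HasDerivAt y (b s) s ∧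
    HasDerivAt t (2 * y s * a s - 2 * x s * b s) s ∧ HasDerivAt l (-k s) s ∧ 0 ≤ k s ∧
    Real.sqrt (a s ^ 2 + b s ^ 2) = (1 + σ) * k s
  lpos : ∀ s ∈ Set.Icc (0:ℝ) 1, 0 < l s

section crv
variable {x y t l a b k : ℝ → ℝ} {σ d α β : ℝ}

theorem sub01 (h0 : 0 ≤ α) (hab : α ≤ β) (h1 : β ≤ 1) : Set.uIcc α β ⊆ Set.uIcc 0 1 := by
  rw [Set.uIcc_of_le hab, Set.uIcc_of_le zero_le_one]
  exact Set.Icc_subset_Icc h0 h1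

theorem aci_sq {f : ℝ → ℝ} (hf : ACI f α β) : ACI (fun s => f s ^ 2) α β := by
  have := hf.mul hf
  simp only [pow_two]
  exact this

theorem rho_ac (H : Crv x y t l a b k σ) (h0 : 0 ≤ α) (hab : α ≤ β) (h1 : β ≤ 1)
    (hr : ∀ s ∈ Set.Icc α β, 0 < rho d x y s) : ACI (rho d x y) α β := by
  have hs := sub01 h0 hab h1
  have h : ACI (fun s => x s ^ 2 + y s ^ 2 + d) α β :=
    ((aci_sq (H.acx.mono hs)).add (aci_sq (H.acy.mono hs))).add (aci_const d α β)
  exact aci_sqrt h fun s hs => Real.sqrt_pos.1 (hr s (by rwa [Set.uIcc_of_le hab] at hs))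

theorem ang_ac (H : Crv x y t l a b k σ) (h0 : 0 ≤ α) (hab : α ≤ β) (h1 : β ≤ 1)
    (hr : ∀ s ∈ Set.Icc α β, 0 < rho d x y s) : ACI (ang d x y l) α β := by
  have hs := sub01 h0 hab h1
  have h : ACI (fun s => l s * (rho d x y s)⁻¹) α β :=
    (H.acl.mono hs).mul (aci_inv (rho_ac H h0 hab h1 hr) (by rwa [Set.uIcc_of_le hab]))
  refine aci_comp_lip (f := fun s => l s * (rho d x y s)⁻¹) (G := Phi) h Phi_lip fun s hs => ?_
  rw [Set.uIcc_of_le hab] at hs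
  have h2 := hr s hs
  have h3 := H.lpos s ⟨h0.trans hs.1, hs.2.trans h1⟩
  simp only [Set.mem_Ici]; positivity

theorem icos_ac (H : Crv x y t l a b k σ) (h0 : 0 ≤ α) (hab : α ≤ β) (h1 : β ≤ 1)
    (hr : ∀ s ∈ Set.Icc α β, 0 < rho d x y s) :
    ACI (fun s => (Real.cos (ang d x y l s))⁻¹) α β :=
  aci_inv (aci_cos (ang_ac H h0 hab h1 hr)) fun _ _ => cosang_pos

theorem tng_ac (H : Crv x y t l a b k σ) (h0 : 0 ≤ α) (hab : α ≤ β) (h1 : β ≤ 1)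
    (hr : ∀ s ∈ Set.Icc α β, 0 < rho d x y s) : ACI (tng d x y l) α β :=
  (aci_sin (ang_ac H h0 hab h1 hr)).mul (icos_ac H h0 hab h1 hr)

theorem M_ac (H : Crv x y t l a b k σ) (h0 : 0 ≤ α) (hab : α ≤ β) (h1 : β ≤ 1)
    (hr : ∀ s ∈ Set.Icc α β, 0 < rho d x y s) : ACI (Mf d x y t l) α β := by
  have hs := sub01 h0 hab h1
  have h : ACI (fun s => x s ^ 2 + y s ^ 2 + d) α β :=
    ((aci_sq (H.acx.mono hs)).add (aci_sq (H.acy.mono hs))).add (aci_const d α β)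
  have hc := icos_ac H h0 hab h1 hr
  exact (H.act.mono hs).add
    (h.mul (((ang_ac H h0 hab h1 hr).mul (hc.mul hc)).add (tng_ac H h0 hab h1 hr)))

theorem rho_bd (H : Crv x y t l a b k σ) (hd : 0 < d) (hs0 : 0 ≤ α) (hs1 : α ≤ 1) :
    rho d x y α + (1 + σ) * l α ≤ rho d x y 0 + (1 + σ) * l 0 := by
  have hr : ∀ s, 0 < rho d x y s := fun s => Real.sqrt_pos.2 (by positivity)
  have hac : ACI (fun s => -(rho d x y s + (1 + σ) * l s)) 0 α :=
    ((rho_ac H le_rfl hs0 hs1 (fun s _ => hr s)).add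
      ((H.acl.mono (sub01 le_rfl hs0 hs1)).const_mul (1 + σ))).neg
  have := aci_mono hac hs0 (by
    filter_upwards [H.der] with s hs hm
    obtain ⟨hx, hy, ht, hl, hk, hu⟩ := hs ⟨hm.1, hm.2.trans hs1⟩
    refine ⟨_, ((rho_deriv (hr s) hx hy).add (hl.const_mul (1 + σ))).neg, ?_⟩
    have h1 : (x s * a s + y s * b s) / rho d x y s ≤ (1 + σ) * k s := by
      rw [← hu, div_le_iff₀ (hr s), rho, ← Real.sqrt_mul (by positivity)]
      apply Real.le_sqrt_of_sq_le
      nlinarith [sq_nonneg (x s * b s - y s * a s), mul_nonneg hd.le (add_nonneg (sq_nonneg (a s)) (sq_nonneg (b s)))]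
    linarith)
  linarith

theorem ang_bds (s : ℝ) : 0 ≤ ang d x y l s ∧ ang d x y l s < Real.pi / 2 ∧
    0 ≤ Real.sin (ang d x y l s) ∧ Real.sin (ang d x y l s) ≤ 1 ∧
    0 < Real.cos (ang d x y l s) ∧ Real.cos (ang d x y l s) ≤ 1 ∧
    1 ≤ Real.cos (ang d x y l s) + ang d x y l s ∧
    Real.cos (ang d x y l s) + ang d x y l s ≤ Real.pi / 2 := by
  have h1 : 0 ≤ ang d x y l s := Phi_nonneg _
  have h2 : ang d x y l s < Real.pi / 2 := Phi_lt _
  have h3 : 0 ≤ Real.sin (ang d x y l s) :=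
    Real.sin_nonneg_of_nonneg_of_le_pi h1 (by linarith [Real.pi_pos])
  refine ⟨h1, h2, h3, Real.sin_le_one _, cosang_pos, Real.cos_le_one _, ?_, ?_⟩
  · have := one_le_CS h1 h2.le
    nlinarith [Real.sin_le_one (ang d x y l s)]
  · have := Real.sin_le (x := Real.pi / 2 - ang d x y l s) (by linarith)
    rw [Real.sin_pi_div_two_sub] at this
    linarith

theorem rough (H : Crv x y t l a b k σ) (hσ : 0 ≤ σ) (hd : 0 ≤ d) (h0 : 0 ≤ α) (hab : α ≤ β) (h1 : β ≤ 1)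
    (hr : ∀ s ∈ Set.Icc α β, 0 < rho d x y s) (hb : ∀ s ∈ Set.Icc α β, rho d x y s + l s ≤ 10) :
    Mf d x y t l β ≤ Mf d x y t l α + 20 * σ * (l α - l β) := by
  have hac : ACI (fun s => -(20 * σ * l s + Mf d x y t l s)) α β :=
    (((H.acl.mono (sub01 h0 hab h1)).const_mul (20 * σ)).add (M_ac H h0 hab h1 hr)).neg
  have := aci_mono hac hab (by
    filter_upwards [H.der] with s hs hm
    have hm1 : s ∈ Set.Icc (0:ℝ) 1 := ⟨h0.trans hm.1, hm.2.trans h1⟩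
    obtain ⟨hx, hy, ht, hl, hk, hu⟩ := hs hm1
    have hl0 := H.lpos s hm1
    have hrs := hr s hm
    refine ⟨_, ((hl.const_mul (20 * σ)).add (M_deriv hrs hl0 hx hy hl ht)).neg, ?_⟩
    obtain ⟨g1, g2, g3, g4, g5, g6, g7, g8⟩ := ang_bds (d := d) (x := x) (y := y) (l := l) s
    have hrel := ang_rel hrs hl0.le
    have hm10 : rho d x y s ≤ 10 * Real.cos (ang d x y l s) := by
      have h5 := mul_le_mul_of_nonneg_right (hb s hm) g5.le
      have h6 := mul_le_mul_of_nonneg_left g7 hrs.le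
      linarith
    have := key_rough hrs hd (rho_sq hrs) (Real.sqrt_nonneg _)
      (Real.sq_sqrt (by positivity : 0 ≤ a s ^ 2 + b s ^ 2)) g5
      (Real.sin_sq_add_cos_sq (ang d x y l s)) hm10 hk hσ hu
    linarith)
  linarith

theorem V_nonneg (hd : 0 ≤ d) (s : ℝ) : t s + (x s ^ 2 + y s ^ 2 + d) * tng d x y l s ≤ Mf d x y t l s := by
  obtain ⟨g1, g2, g3, g4, g5, g6, g7, g8⟩ := ang_bds (d := d) (x := x) (y := y) (l := l) s
  have : 0 ≤ (x s ^ 2 + y s ^ 2 + d) * (ang d x y l s * ((Real.cos (ang d x y l s))⁻¹ * (Real.cos (ang d x y l s))⁻¹)) := by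
    positivity
  unfold Mf
  linarith

theorem tng_nonneg (s : ℝ) : 0 ≤ tng d x y l s := by
  obtain ⟨g1, g2, g3, g4, g5, g6, g7, g8⟩ := ang_bds (d := d) (x := x) (y := y) (l := l) s
  unfold tng
  positivity

theorem M_tendsto {s : ℝ} (hr : 0 < rho 0 x y s) (hl : 0 < l s) :
    Filter.Tendsto (fun d => Mf d x y t l s) (nhdsWithin 0 (Set.Ioi 0)) (nhds (Mf 0 x y t l s)) := by
  have h1 : ContinuousAt (fun d => rho d x y s) 0 := by
    unfold rho; fun_prop
  have h2 : ContinuousAt (fun d => ang d x y l s) 0 := by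
    have hc : ContinuousAt Phi (l s * (rho 0 x y s)⁻¹) :=
      (Phi_deriv (by positivity)).continuousAt
    exact ContinuousAt.comp (f := fun d => l s * (rho d x y s)⁻¹) (g := Phi) hc
      (continuousAt_const.mul (h1.inv₀ hr.ne'))
  have h3 : ContinuousAt (fun d => (Real.cos (ang d x y l s))⁻¹) 0 :=
    (Real.continuous_cos.continuousAt.comp h2).inv₀ cosang_pos.ne'
  have h4 : ContinuousAt (fun d => Real.sin (ang d x y l s)) 0 :=
    (Real.continuous_sin.continuousAt.comp h2)
  have h5 : ContinuousAt (fun d => Mf d x y t l s) 0 := by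
    unfold Mf tng
    fun_prop
  exact h5.tendsto.mono_left nhdsWithin_le_nhds

/-- lower bound on `M` at intermediate times -/
theorem M_lower (H : Crv x y t l a b k σ) (hσ : 0 ≤ σ) (hσ1 : σ ≤ 1 / 100)
    (ht : 0 < t 1) (hl0 : l 0 ≤ Real.pi) (hr0 : rho 0 x y 0 ≤ 2)
    (h0 : 0 ≤ α) (h1 : α ≤ 1) (hr : 0 < rho 0 x y α) :
    0 ≤ Mf 0 x y t l α + 20 * σ * l α := by
  have hl := H.lpos α ⟨h0, h1⟩
  refine ge_of_tendsto ((M_tendsto (t := t) hr hl).add_const _) ?_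
  have : ∀ᶠ d in nhdsWithin (0:ℝ) (Set.Ioi 0), 0 < d ∧ d < 1 :=
    Ioo_mem_nhdsGT (by norm_num)
  filter_upwards [this] with d hd
  have hrd : ∀ s, 0 < rho d x y s := fun s => Real.sqrt_pos.2 (by nlinarith [sq_nonneg (x s), sq_nonneg (y s), hd.1])
  have h01 : rho d x y 0 ≤ 3 := by
    unfold rho at hr0 ⊢
    rw [Real.sqrt_le_left (by norm_num)] at hr0 ⊢
    linarith [hd.2]
  have := rough H hσ hd.1.le h0 h1 le_rfl (fun s _ => hrd s) (fun s hs => by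
    have h2 := rho_bd H hd.1 (h0.trans hs.1) hs.2
    have h3 := H.lpos s ⟨h0.trans hs.1, hs.2⟩
    have h4 := H.lpos 0 ⟨le_rfl, zero_le_one⟩
    have := Real.pi_lt_d2
    nlinarith)
  have h5 := V_nonneg (x := x) (y := y) (t := t) (l := l) hd.1.le 1
  have h6 := tng_nonneg (d := d) (x := x) (y := y) (l := l) 1
  have h7 := H.lpos 1 ⟨zero_le_one, le_rfl⟩
  have h8 : 0 ≤ (x 1 ^ 2 + y 1 ^ 2 + d) * tng d x y l 1 :=
    mul_nonneg (by nlinarith [sq_nonneg (x 1), sq_nonneg (y 1), hd.1]) h6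
  have h9 : 0 ≤ σ * l 1 := by positivity
  linarith

end crv

section boot
variable {x y t l a b k : ℝ → ℝ} {h p0 : ℝ}

/-- derivative package on a good interval -/
theorem good_der (H : Crv x y t l a b k ((h ^ 4) ^ 2)) (hh : 0 < h) (hh1 : h ≤ 1 / 100) {s1 : ℝ} (hs1 : s1 ≤ 1)
    (hg1 : ∀ s ∈ Set.Icc 0 s1, h / 10 ≤ rho 0 x y s)
    (hg2 : ∀ s ∈ Set.Icc 0 s1, 1.6 ≤ rho 0 x y s + l s)
    (hg3 : ∀ s ∈ Set.Icc 0 s1, rho 0 x y s + l s ≤ 10) :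
    ∀ᵐ s ∂volume, s ∈ Set.Icc 0 s1 → ∃ B D1 D2 D3, 0 ≤ B ∧
      HasDerivAt (fun s => -(12 * h ^ 4 * l s + (2 * h ^ 4)⁻¹ * Mf 0 x y t l s)) B s ∧
      HasDerivAt (ang 0 x y l) D1 s ∧ D1 ≤ 2 * B ∧
      HasDerivAt (fun s => x s + y s * tng 0 x y l s) D2 s ∧
        |D2| ≤ 4 * B / Real.cos (ang 0 x y l s) ∧
      HasDerivAt (fun s => y s - x s * tng 0 x y l s) D3 s ∧
        |D3| ≤ 4 * B / Real.cos (ang 0 x y l s) := by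
  filter_upwards [H.der] with s hs hm
  have hm1 : s ∈ Set.Icc (0:ℝ) 1 := ⟨hm.1, hm.2.trans hs1⟩
  obtain ⟨hx, hy, ht, hl, hk, hu⟩ := hs hm1
  have hl0 := H.lpos s hm1
  have hrs : 0 < rho 0 x y s := lt_of_lt_of_le (by positivity) (hg1 s hm)
  obtain ⟨g1, g2, g3, g4, g5, g6, g7, g8⟩ := ang_bds (d := 0) (x := x) (y := y) (l := l) s
  have hrel := ang_rel hrs hl0.le
  have hpi := Real.pi_lt_d2
  have hm10 : rho 0 x y s ≤ 10 * Real.cos (ang 0 x y l s) := by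
    have h5 := mul_le_mul_of_nonneg_right (hg3 s hm) g5.le
    have h6 := mul_le_mul_of_nonneg_left g7 hrs.le
    linarith
  have hm11 : Real.cos (ang 0 x y l s) ≤ rho 0 x y s := by
    have h5 := mul_le_mul_of_nonneg_right (hg2 s hm) g5.le
    have h6 : rho 0 x y s * (Real.cos (ang 0 x y l s) + ang 0 x y l s) ≤ rho 0 x y s * 1.6 :=
      mul_le_mul_of_nonneg_left (by linarith) hrs.le
    linarith
  have hr2 := rho_sq hrs
  rw [add_zero] at hr2
  have hSp : ang 0 x y l s * Real.cos (ang 0 x y l s) ≤ Real.sin (ang 0 x y l s) :=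
    by
      have := Real.le_tan g1 g2
      rwa [Real.tan_eq_sin_div_cos, le_div_iff₀ g5] at this
  have hη : h ^ 4 ≤ 1 := pow_le_one₀ hh.le (by linarith)
  obtain ⟨k1, k2, k3, k4⟩ := key_fine hrs hr2 (Real.sqrt_nonneg _)
      (Real.sq_sqrt (by positivity : 0 ≤ a s ^ 2 + b s ^ 2)) g5 g6 g3 g4
      (Real.sin_sq_add_cos_sq (ang 0 x y l s)) hm10 hm11 hk (show 0 < h ^ 4 by positivity) hη hu
      g1 (by linarith) (one_le_CS g1 g2.le) hSp
  have hT := tng_deriv hrs hl0 hx hy hl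
  refine ⟨_, _, _, _, k1, ?_, ang_deriv hrs hl0 hx hy hl, k2, hx.add (hy.mul hT), ?_,
    hy.sub (hx.mul hT), ?_⟩
  · refine ((hl.const_mul (12 * h ^ 4)).add
      ((M_deriv hrs hl0 hx hy hl ht).const_mul ((2 * h ^ 4)⁻¹))).neg.congr_deriv ?_
    ring
  · exact k3
  · exact k4

theorem boot (H : Crv x y t l a b k ((h ^ 4) ^ 2)) (hh : 0 < h) (hh1 : h ≤ 1 / 100)
    (ht : 0 < t 1) (hp0 : 0 < p0) (hp1 : p0 < Real.pi / 2) (hc : h / 3.2 ≤ Real.cos p0)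
    (hl0 : l 0 = 2 * p0) (hx0 : x 0 = 2 * Real.cos p0 ^ 2) (hy0 : y 0 = 2 * Real.sin p0 * Real.cos p0)
    (ht0 : t 0 = - 4 * (p0 + Real.sin p0 * Real.cos p0))
    {s1 : ℝ} (hs0 : 0 ≤ s1) (hs1 : s1 ≤ 1)
    (hg1 : ∀ s ∈ Set.Icc 0 s1, h / 10 ≤ rho 0 x y s)
    (hg2 : ∀ s ∈ Set.Icc 0 s1, 1.6 ≤ rho 0 x y s + l s) :
    h / 4 ≤ Real.cos (ang 0 x y l s1) ∧
    |x s1 + y s1 * tng 0 x y l s1 - 2| ≤ 1120 * h ^ 3 ∧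
    |y s1 - x s1 * tng 0 x y l s1| ≤ 1120 * h ^ 3 ∧
    Mf 0 x y t l s1 ≤ 70 * h ^ 8 := by
  have hcp : 0 < Real.cos p0 := lt_of_lt_of_le (by positivity) hc
  have hcs := Real.sin_sq_add_cos_sq p0
  have hpi := Real.pi_lt_d2
  have hσ1 : (h ^ 4) ^ 2 ≤ 1 / 100 := by
    have : (h ^ 4) ^ 2 ≤ ((1 / 100) ^ 4) ^ 2 := by gcongr
    exact this.trans (by norm_num)
  have hr0 : rho 0 x y 0 = 2 * Real.cos p0 := by
    unfold rho
    rw [hx0, hy0, Real.sqrt_eq_iff_mul_self_eq (by positivity) (by positivity)]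
    linear_combination (4 * Real.cos p0 ^ 2) * hcs
  have ha0 : ang 0 x y l 0 = p0 := by
    unfold ang
    apply Phi_unique _ hp0.le hp1
    · rw [hr0, hl0]; field_simp
    · rw [hr0, hl0]; positivity
  have hM0 : Mf 0 x y t l 0 = 0 := by
    unfold Mf tng
    rw [ha0, hx0, hy0, ht0]
    have hS : Real.sin p0 ^ 2 = 1 - Real.cos p0 ^ 2 := by linarith
    field_simp
    simp only [hS]; ring
  have hT0 : tng 0 x y l 0 = Real.sin p0 * (Real.cos p0)⁻¹ := by unfold tng; rw [ha0]
  have hrp : ∀ s ∈ Set.Icc 0 s1, 0 < rho 0 x y s := fun s hs =>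
    lt_of_lt_of_le (by positivity) (hg1 s hs)
  have hr02 : rho 0 x y 0 ≤ 2 := by rw [hr0]; linarith [Real.cos_le_one p0]
  have hg3 : ∀ s ∈ Set.Icc 0 s1, rho 0 x y s + l s ≤ 10 := by
    intro s hs
    have h1 := rho_bd H one_pos hs.1 (hs.2.trans hs1)
    have h2 : rho 0 x y s ≤ rho 1 x y s := by unfold rho; gcongr; norm_num
    have h3 : rho 1 x y 0 ≤ 3 := by
      unfold rho at hr02 ⊢
      rw [Real.sqrt_le_left (by norm_num)] at hr02 ⊢
      linarith
    have h4 := H.lpos s ⟨hs.1, hs.2.trans hs1⟩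
    have h5 := H.lpos 0 ⟨le_rfl, zero_le_one⟩
    have h6 : 0 ≤ (h ^ 4) ^ 2 * l s := by positivity
    have h7 : (h ^ 4) ^ 2 * l 0 ≤ 1 / 100 * l 0 := mul_le_mul_of_nonneg_right hσ1 h5.le
    linarith
  have hder := good_der H hh hh1 hs1 hg1 hg2 hg3
  set Z : ℝ → ℝ := fun s => -(12 * h ^ 4 * l s + (2 * h ^ 4)⁻¹ * Mf 0 x y t l s) with hZ
  have hsub : ∀ {s}, s ∈ Set.Icc 0 s1 → ∀ r ∈ Set.Icc 0 s, r ∈ Set.Icc 0 s1 :=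
    fun hs r hr => ⟨hr.1, hr.2.trans hs.2⟩
  have hZac : ∀ s ∈ Set.Icc 0 s1, ACI Z 0 s := fun s hs =>
    (((H.acl.mono (sub01 le_rfl hs.1 (hs.2.trans hs1))).const_mul (12 * h ^ 4)).add
      ((M_ac H le_rfl hs.1 (hs.2.trans hs1) (fun r hr => hrp r (hsub hs r hr))).const_mul
        ((2 * h ^ 4)⁻¹))).neg
  have hZb : ∀ s ∈ Set.Icc 0 s1, Z s - Z 0 ≤ 70 * h ^ 4 := by
    intro s hs
    have h1 := M_lower H (by positivity) hσ1 ht (by rw [hl0]; linarith) hr02 hs.1 (hs.2.trans hs1)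
      (hrp s hs)
    have h2 : 0 < l s := H.lpos s ⟨hs.1, hs.2.trans hs1⟩
    have h8 : l s ≤ l 0 := by
      have := aci_mono ((H.acl.mono (sub01 le_rfl hs.1 (hs.2.trans hs1))).neg) hs.1 (by
        filter_upwards [H.der] with r hr hm
        obtain ⟨-, -, -, hl, hk, -⟩ := hr ⟨hm.1, hm.2.trans (hs.2.trans hs1)⟩
        exact ⟨_, hl.neg, by linarith⟩)
      simp only [Pi.neg_apply] at this
      linarith
    have h3 : -((2 * h ^ 4)⁻¹ * Mf 0 x y t l s) ≤ 10 * h ^ 4 * l s := by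
      rw [← mul_neg, inv_mul_le_iff₀ (by positivity)]
      linarith
    have h4 : Z s - Z 0 = 12 * h ^ 4 * l 0 - 12 * h ^ 4 * l s - (2 * h ^ 4)⁻¹ * Mf 0 x y t l s := by
      simp only [hZ]; rw [hM0]; ring
    rw [h4, hl0]
    rw [hl0] at h8
    have h5 : 0 < h ^ 4 := by positivity
    have h6 := mul_le_mul_of_nonneg_left h8 h5.le
    have h7 : h ^ 4 * (2 * p0) ≤ h ^ 4 * 3.15 := mul_le_mul_of_nonneg_left (by linarith) h5.le
    nlinarith
  have h3b : h ^ 3 ≤ 1 / 1000000 := by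
    have : h ^ 3 ≤ (1 / 100) ^ 3 := by gcongr
    exact this.trans (by norm_num)
  have hC : ∀ s ∈ Set.Icc 0 s1, h / 4 ≤ Real.cos (ang 0 x y l s) := by
    intro s hs
    have hs1' := hs.2.trans hs1
    have hrp' := fun r hr => hrp r (hsub hs r hr)
    have := aci_mono (((hZac s hs).const_mul 2).sub (ang_ac H le_rfl hs.1 hs1' hrp')) hs.1 (by
      filter_upwards [hder] with r hr hm
      obtain ⟨B, D1, D2, D3, hB, hZd, hD1, hD1b, -⟩ := hr (hsub hs r hm)
      exact ⟨_, (hZd.const_mul 2).sub hD1, by linarith⟩)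
    simp only [Pi.sub_apply, ha0] at this
    have h1 := hZb s hs
    obtain ⟨g1, g2, -⟩ := ang_bds (d := 0) (x := x) (y := y) (l := l) s
    have h2 : Real.cos (p0 + 140 * h ^ 4) ≤ Real.cos (ang 0 x y l s) := by
      apply Real.cos_le_cos_of_nonneg_of_le_pi g1
      · have : h ^ 4 = h * h ^ 3 := by ring
        nlinarith [Real.pi_gt_d2]
      · linarith
    have h3 : Real.cos p0 - 140 * h ^ 4 ≤ Real.cos (p0 + 140 * h ^ 4) := by
      have hsn := Real.sin_le (show 0 ≤ 140 * h ^ 4 by positivity)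
      have hcn := Real.one_sub_sq_div_two_le_cos (x := 140 * h ^ 4)
      have := Real.abs_cos_sub_cos_le p0 (p0 + 140 * h ^ 4)
      have h6 := (abs_le.1 this).2
      rw [show p0 - (p0 + 140 * h ^ 4) = - (140 * h ^ 4) by ring, abs_neg,
        abs_of_nonneg (by positivity)] at h6
      linarith
    have h4 : h ^ 4 = h * h ^ 3 := by ring
    have h5 : h * h ^ 3 ≤ h * (1 / 1000000) := mul_le_mul_of_nonneg_left h3b hh.le
    have h7 : h / 3.2 = h * (5 / 16) := by norm_num; ring
    rw [h7] at hc
    rw [h4] at h2 h3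
    linarith
  have hs1m : s1 ∈ Set.Icc 0 s1 := ⟨hs0, le_rfl⟩
  have h4c : ∀ s ∈ Set.Icc 0 s1, ∀ B, 0 ≤ B → 4 * B / Real.cos (ang 0 x y l s) ≤ 16 / h * B := by
    intro s hs B hB
    have hc1 := hC s hs
    have hc2 : 0 < Real.cos (ang 0 x y l s) := cosang_pos
    rw [div_le_iff₀ hc2]
    have : 16 / h * B * (h / 4) ≤ 16 / h * B * Real.cos (ang 0 x y l s) :=
      mul_le_mul_of_nonneg_left hc1 (by positivity)
    have e : 16 / h * B * (h / 4) = 4 * B := by field_simp; ring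
    linarith
  have hZs : 16 / h * (Z s1 - Z 0) ≤ 1120 * h ^ 3 := by
    have : 16 / h * (Z s1 - Z 0) ≤ 16 / h * (70 * h ^ 4) :=
      mul_le_mul_of_nonneg_left (hZb s1 hs1m) (by positivity)
    have e : 16 / h * (70 * h ^ 4) = 1120 * h ^ 3 := by field_simp; ring
    linarith
  have hTac := tng_ac H le_rfl hs0 hs1 hrp
  have hZ1 := (hZac s1 hs1m).const_mul (16 / h)
  have hss := sub01 le_rfl hs0 hs1
  have hE1ac : ACI (fun s => x s + y s * tng 0 x y l s) 0 s1 :=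
    (H.acx.mono hss).add ((H.acy.mono hss).mul hTac)
  have hE2ac : ACI (fun s => y s - x s * tng 0 x y l s) 0 s1 :=
    (H.acy.mono hss).sub ((H.acx.mono hss).mul hTac)
  have hE10 : x 0 + y 0 * tng 0 x y l 0 = 2 := by
    rw [hT0, hx0, hy0]; field_simp; linear_combination hcs
  have hE20 : y 0 - x 0 * tng 0 x y l 0 = 0 := by
    rw [hT0, hx0, hy0]; field_simp; ring
  have q1 := aci_mono (hZ1.sub hE1ac) hs0 (by
    filter_upwards [hder] with r hr hm
    obtain ⟨B, D1, D2, D3, hB, hZd, -, -, hd2, hb2, hd3, hb3⟩ := hr hm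
    exact ⟨_, (hZd.const_mul (16 / h)).sub hd2, by linarith [h4c r hm B hB, le_abs_self D2]⟩)
  have q2 := aci_mono (hZ1.add hE1ac) hs0 (by
    filter_upwards [hder] with r hr hm
    obtain ⟨B, D1, D2, D3, hB, hZd, -, -, hd2, hb2, hd3, hb3⟩ := hr hm
    exact ⟨_, (hZd.const_mul (16 / h)).add hd2, by linarith [h4c r hm B hB, neg_abs_le D2]⟩)
  have q3 := aci_mono (hZ1.sub hE2ac) hs0 (by
    filter_upwards [hder] with r hr hm
    obtain ⟨B, D1, D2, D3, hB, hZd, -, -, hd2, hb2, hd3, hb3⟩ := hr hm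
    exact ⟨_, (hZd.const_mul (16 / h)).sub hd3, by linarith [h4c r hm B hB, le_abs_self D3]⟩)
  have q4 := aci_mono (hZ1.add hE2ac) hs0 (by
    filter_upwards [hder] with r hr hm
    obtain ⟨B, D1, D2, D3, hB, hZd, -, -, hd2, hb2, hd3, hb3⟩ := hr hm
    exact ⟨_, (hZd.const_mul (16 / h)).add hd3, by linarith [h4c r hm B hB, neg_abs_le D3]⟩)
  simp only [Pi.sub_apply, Pi.add_apply, hE10, hE20] at q1 q2 q3 q4
  refine ⟨hC s1 hs1m, ?_, ?_, ?_⟩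
  · rw [abs_le]; constructor <;> linarith
  · rw [abs_le]; constructor <;> linarith
  · have := rough H (by positivity) le_rfl le_rfl hs0 hs1 hrp hg3
    rw [hM0, hl0] at this
    have h1 : 0 < l s1 := H.lpos s1 ⟨hs0, hs1⟩
    have h2 : (h ^ 4) ^ 2 * (2 * p0 - l s1) ≤ (h ^ 4) ^ 2 * 3.15 :=
      mul_le_mul_of_nonneg_left (by linarith) (by positivity)
    have e : (h ^ 4) ^ 2 = h ^ 8 := by ring
    rw [e] at h2 this
    have : 0 < h ^ 8 := by positivity
    linarith

theorem first_exit {m : ℝ → ℝ} (hm : ContinuousOn m (Set.Icc 0 1)) (h0 : 0 < m 0)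
    (step : ∀ s1, 0 ≤ s1 → s1 ≤ 1 → (∀ s ∈ Set.Icc 0 s1, 0 ≤ m s) → 0 < m s1) :
    ∀ s ∈ Set.Icc (0:ℝ) 1, 0 < m s := by
  by_contra! hcon
  obtain ⟨s, hs, hms⟩ := hcon
  have hcl : IsCompact (Set.Icc (0:ℝ) 1 ∩ m ⁻¹' Set.Iic 0) :=
    isCompact_Icc.of_isClosed_subset (hm.preimage_isClosed_of_isClosed isClosed_Icc isClosed_Iic)
      Set.inter_subset_left
  obtain ⟨s1, hs1, hleast⟩ := hcl.exists_isLeast ⟨s, hs, hms⟩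
  have hm1 : m s1 ≤ 0 := hs1.2
  have hge : 0 ≤ m s1 := by
    have := intermediate_value_Icc' hs1.1.1 (hm.mono (Set.Icc_subset_Icc le_rfl hs1.1.2))
    obtain ⟨r, hr, hr0⟩ := this ⟨hm1, h0.le⟩
    have : s1 ≤ r := hleast ⟨⟨hr.1, hr.2.trans hs1.1.2⟩, hr0.le⟩
    have : r = s1 := le_antisymm hr.2 this
    rw [← this, hr0]
  have := step s1 hs1.1.1 hs1.1.2 (fun r hr => by
    rcases eq_or_lt_of_le hr.2 with h | h
    · rw [h]; exact hge
    · by_contra! hc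
      exact absurd (hleast ⟨⟨hr.1, hr.2.trans hs1.1.2⟩, hc.le⟩) (not_le.2 h))
  linarith

theorem core (H : Crv x y t l a b k ((h ^ 4) ^ 2)) (hh : 0 < h) (hh1 : h ≤ 1 / 100)
    (ht : 0 < t 1) (hp0 : 0 < p0) (hp1 : p0 < Real.pi / 2) (hc : h / 3.2 ≤ Real.cos p0)
    (hl0 : l 0 = 2 * p0) (hx0 : x 0 = 2 * Real.cos p0 ^ 2) (hy0 : y 0 = 2 * Real.sin p0 * Real.cos p0)
    (ht0 : t 0 = - 4 * (p0 + Real.sin p0 * Real.cos p0)) :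
    |x 1 - 2| ≤ 2000 * h ^ 2 ∧ |y 1| ≤ 2000 * h ^ 2 := by
  have hcp : 0 < Real.cos p0 := lt_of_lt_of_le (by positivity) hc
  have hcs := Real.sin_sq_add_cos_sq p0
  have h3b : h ^ 3 ≤ 1 / 1000000 := by
    have : h ^ 3 ≤ (1 / 100) ^ 3 := by gcongr
    exact this.trans (by norm_num)
  have hr0 : rho 0 x y 0 = 2 * Real.cos p0 := by
    unfold rho
    rw [hx0, hy0, Real.sqrt_eq_iff_mul_self_eq (by positivity) (by positivity)]
    linear_combination (4 * Real.cos p0 ^ 2) * hcs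
  have hcont : ContinuousOn (rho 0 x y) (Set.Icc 0 1) := by
    have h1 := H.acx.continuousOn
    have h2 := H.acy.continuousOn
    rw [Set.uIcc_of_le zero_le_one] at h1 h2
    unfold rho
    fun_prop
  have hlc := H.acl.continuousOn
  rw [Set.uIcc_of_le zero_le_one] at hlc
  have hcp1 : 1 ≤ Real.cos p0 + p0 := by
    have := one_le_CS hp0.le hp1.le
    nlinarith [Real.sin_le_one p0]
  have hall : ∀ s ∈ Set.Icc (0:ℝ) 1, 0 < min (rho 0 x y s - h / 10) (rho 0 x y s + l s - 1.6) := by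
    apply first_exit
    · exact (hcont.sub continuousOn_const).inf ((hcont.add hlc).sub continuousOn_const)
    · rw [lt_min_iff, hr0, hl0]
      constructor <;> norm_num at hc ⊢ <;> linarith
    · intro s1 hs0 hs1 hg
      have hg1 : ∀ s ∈ Set.Icc 0 s1, h / 10 ≤ rho 0 x y s := fun s hs => by
        have := (le_min_iff.1 (hg s hs)).1; linarith
      have hg2 : ∀ s ∈ Set.Icc 0 s1, 1.6 ≤ rho 0 x y s + l s := fun s hs => by
        have := (le_min_iff.1 (hg s hs)).2; linarith
      obtain ⟨b1, b2, b3, b4⟩ := boot H hh hh1 ht hp0 hp1 hc hl0 hx0 hy0 ht0 hs0 hs1 hg1 hg2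
      have hrs : 0 < rho 0 x y s1 := lt_of_lt_of_le (by positivity) (hg1 s1 ⟨hs0, le_rfl⟩)
      have hls := H.lpos s1 ⟨hs0, hs1⟩
      obtain ⟨g1, g2, g3, g4, g5, g6, g7, g8⟩ := ang_bds (d := 0) (x := x) (y := y) (l := l) s1
      have hrel := ang_rel hrs hls.le
      have hr2 := rho_sq hrs
      have hCS := Real.sin_sq_add_cos_sq (ang 0 x y l s1)
      have hm : 1.9 * Real.cos (ang 0 x y l s1) ≤ rho 0 x y s1 := by
        have e1 : 1.9 ≤ x s1 + y s1 * tng 0 x y l s1 := by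
          have := (abs_le.1 b2).1; norm_num; linarith
        have hT : tng 0 x y l s1 * Real.cos (ang 0 x y l s1) = Real.sin (ang 0 x y l s1) := by
          unfold tng; field_simp
        apply le_of_sq_le_sq _ hrs.le
        rw [hr2]
        generalize Real.cos (ang 0 x y l s1) = C at *
        generalize Real.sin (ang 0 x y l s1) = S at *
        have e2 : 1.9 * C ≤ x s1 * C + y s1 * S := by
          have := mul_le_mul_of_nonneg_right e1 g5.le
          rw [← hT]; linarith
        have e3 : (1.9 * C) ^ 2 ≤ (x s1 * C + y s1 * S) ^ 2 := by gcongr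
        have e4 : (x s1 * C + y s1 * S) ^ 2 = (S ^ 2 + C ^ 2) * (x s1 ^ 2 + y s1 ^ 2) -
          (x s1 * S - y s1 * C) ^ 2 := by ring
        rw [hCS] at e4
        linarith [sq_nonneg (x s1 * S - y s1 * C)]
      rw [lt_min_iff]
      constructor
      · norm_num at hm; linarith
      · have h1 : (rho 0 x y s1 + l s1) * Real.cos (ang 0 x y l s1) =
          rho 0 x y s1 * (Real.cos (ang 0 x y l s1) + ang 0 x y l s1) := by linarith
        have h2 : rho 0 x y s1 * 1 ≤ rho 0 x y s1 * (Real.cos (ang 0 x y l s1) + ang 0 x y l s1) :=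
          mul_le_mul_of_nonneg_left g7 hrs.le
        have h3 : 1.9 * Real.cos (ang 0 x y l s1) ≤ (rho 0 x y s1 + l s1) * Real.cos (ang 0 x y l s1) := by
          linarith
        have := le_of_mul_le_mul_right h3 g5
        norm_num at this ⊢
        linarith
  have hg1 : ∀ s ∈ Set.Icc (0:ℝ) 1, h / 10 ≤ rho 0 x y s := fun s hs => by
    have := (lt_min_iff.1 (hall s hs)).1; linarith
  have hg2 : ∀ s ∈ Set.Icc (0:ℝ) 1, 1.6 ≤ rho 0 x y s + l s := fun s hs => by
    have := (lt_min_iff.1 (hall s hs)).2; linarith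
  obtain ⟨b1, b2, b3, b4⟩ := boot H hh hh1 ht hp0 hp1 hc hl0 hx0 hy0 ht0 zero_le_one le_rfl hg1 hg2
  have hr1 := hg1 1 ⟨zero_le_one, le_rfl⟩
  have hrs : 0 < rho 0 x y 1 := lt_of_lt_of_le (by positivity) hr1
  have hr2 := rho_sq hrs
  have hV := V_nonneg (x := x) (y := y) (t := t) (l := l) (le_refl (0:ℝ)) 1
  have hT := tng_nonneg (d := 0) (x := x) (y := y) (l := l) 1
  rw [← hr2] at hV
  have hrT : rho 0 x y 1 * tng 0 x y l 1 ≤ 700 * h ^ 7 := by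
    have h1 : h / 10 * (rho 0 x y 1 * tng 0 x y l 1) ≤ rho 0 x y 1 * (rho 0 x y 1 * tng 0 x y l 1) :=
      mul_le_mul_of_nonneg_right hr1 (by positivity)
    have h2 : h / 10 * (rho 0 x y 1 * tng 0 x y l 1) ≤ h / 10 * (700 * h ^ 7) := by
      have e : h / 10 * (700 * h ^ 7) = 70 * h ^ 8 := by ring
      rw [e]
      have e2 : rho 0 x y 1 * (rho 0 x y 1 * tng 0 x y l 1) = rho 0 x y 1 ^ 2 * tng 0 x y l 1 := by ring
      linarith
    exact le_of_mul_le_mul_left h2 (by positivity)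
  have hxr : |x 1| ≤ rho 0 x y 1 := abs_le_of_sq_le_sq (by rw [hr2]; nlinarith [sq_nonneg (y 1)]) hrs.le
  have hyr : |y 1| ≤ rho 0 x y 1 := abs_le_of_sq_le_sq (by rw [hr2]; nlinarith [sq_nonneg (x 1)]) hrs.le
  have hxT : |x 1 * tng 0 x y l 1| ≤ 700 * h ^ 7 := by
    rw [abs_mul, abs_of_nonneg hT]
    exact (mul_le_mul_of_nonneg_right hxr hT).trans hrT
  have hyT : |y 1 * tng 0 x y l 1| ≤ 700 * h ^ 7 := by
    rw [abs_mul, abs_of_nonneg hT]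
    exact (mul_le_mul_of_nonneg_right hyr hT).trans hrT
  have hh3 : h ^ 3 ≤ h ^ 2 := pow_le_pow_of_le_one hh.le (by linarith) (by norm_num)
  have hh7 : h ^ 7 ≤ h ^ 2 := pow_le_pow_of_le_one hh.le (by linarith) (by norm_num)
  have hh2 : 0 ≤ h ^ 2 := by positivity
  rw [abs_le] at *
  rw [abs_le]
  exact ⟨⟨by linarith, by linarith⟩, ⟨by linarith, by linarith⟩⟩

end boot

/-- the set of lengths defining `dH` -/
def Lset (P Q : H) : Set ℝ := { L : ℝ | ∃ (γ : ℝ → H) (a b : ℝ → ℝ) (K : NNReal),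
    LipschitzWith K γ ∧ γ 0 = P ∧ γ 1 = Q ∧
    (∀ᵐ s ∂volume, s ∈ Set.Icc (0:ℝ) 1 →
      HasDerivAt γ (a s, b s, 2 * (γ s).2.1 * a s - 2 * (γ s).1 * b s) s) ∧
    IntervalIntegrable (fun s => Real.sqrt (a s ^ 2 + b s ^ 2)) volume 0 1 ∧
    L = ∫ s in (0:ℝ)..1, Real.sqrt (a s ^ 2 + b s ^ 2) }

theorem Lset_mem {x y t a b : ℝ → ℝ} (hx : ∀ s, HasDerivAt x (a s) s)
    (hy : ∀ s, HasDerivAt y (b s) s)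
    (ht : ∀ s, HasDerivAt t (2 * y s * a s - 2 * x s * b s) s)
    (ha : Continuous a) (hb : Continuous b) :
    (∫ s in (0:ℝ)..1, Real.sqrt (a s ^ 2 + b s ^ 2)) ∈
      Lset (x 0, y 0, t 0) (x 1, y 1, t 1) := by
  have hxc : Continuous x := continuous_iff_continuousAt.2 fun s => (hx s).continuousAt
  have hyc : Continuous y := continuous_iff_continuousAt.2 fun s => (hy s).continuousAt
  set c : ℝ → H := fun s => (x s, y s, t s) with hc
  set c' : ℝ → H := fun s => (a s, b s, 2 * y s * a s - 2 * x s * b s) with hc'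
  have hd : ∀ s, HasDerivAt c (c' s) s := fun s => (hx s).prodMk ((hy s).prodMk (ht s))
  have hcc : Continuous c' := by fun_prop
  obtain ⟨C, hC⟩ := (isCompact_Icc (a := (0:ℝ)) (b := 1)).exists_bound_of_continuousOn
    hcc.continuousOn
  have hlip : LipschitzOnWith C.toNNReal c (Set.Icc 0 1) := by
    apply (convex_Icc (0:ℝ) 1).lipschitzOnWith_of_nnnorm_hasDerivWithin_le
      (f' := c') (fun s _ => (hd s).hasDerivWithinAt)
    intro s hs
    rw [← NNReal.coe_le_coe, coe_nnnorm]
    exact (hC s hs).trans (Real.le_coe_toNNReal C)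
  have hpr : LipschitzWith 1 (fun s : ℝ => (Set.projIcc (0:ℝ) 1 zero_le_one s : ℝ)) :=
    LipschitzWith.projIcc zero_le_one
  refine ⟨fun s => c (Set.projIcc (0:ℝ) 1 zero_le_one s), a, b, C.toNNReal, ?_, ?_, ?_, ?_, ?_, rfl⟩
  · intro u v
    have h1 := hlip (Set.projIcc (0:ℝ) 1 zero_le_one u).2 (Set.projIcc (0:ℝ) 1 zero_le_one v).2
    have h2 := hpr u v
    rw [ENNReal.coe_one, one_mul] at h2
    exact h1.trans (mul_le_mul_right h2 _)
  · simp [hc]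
  · simp [hc]
  · have h0 : ∀ᵐ s ∂(volume : Measure ℝ), s ≠ 0 := by simp [ae_iff]
    have h1 : ∀ᵐ s ∂(volume : Measure ℝ), s ≠ 1 := by simp [ae_iff]
    filter_upwards [h0, h1] with s h0 h1 hs
    have hm : s ∈ Set.Ioo (0:ℝ) 1 := ⟨lt_of_le_of_ne hs.1 (Ne.symm h0), lt_of_le_of_ne hs.2 h1⟩
    have he : (fun s => c (Set.projIcc (0:ℝ) 1 zero_le_one s)) =ᶠ[nhds s] c := by
      filter_upwards [isOpen_Ioo.mem_nhds hm] with r hr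
      rw [Set.projIcc_of_mem zero_le_one ⟨hr.1.le, hr.2.le⟩]
    have := (hd s).congr_of_eventuallyEq he
    have e : c (Set.projIcc (0:ℝ) 1 zero_le_one s) = c s := he.self_of_nhds
    simp only [e]
    exact this
  · apply Continuous.intervalIntegrable
    fun_prop

theorem Lset_bdd (P Q : H) : BddBelow (Lset P Q) := by
  refine ⟨0, ?_⟩
  rintro L ⟨γ, a, b, K, -, -, -, -, -, rfl⟩
  exact intervalIntegral.integral_nonneg zero_le_one fun s _ => Real.sqrt_nonneg _

theorem Lset_nonempty (P Q : H) : (Lset P Q).Nonempty := by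
  obtain ⟨x0, y0, t0⟩ := P
  obtain ⟨x1, y1, t1⟩ := Q
  obtain ⟨β, hβ⟩ : ∃ β : ℝ, t1 = t0 + 2 * (y0 * (x1 - x0) - x0 * (y1 - y0)) - 2 * (y1 - y0) / 3
      + 2 * β / 15 :=
    ⟨15 / 2 * (t1 - t0 - 2 * (y0 * (x1 - x0) - x0 * (y1 - y0)) + 2 * (y1 - y0) / 3), by ring⟩
  obtain ⟨A, hA⟩ : ∃ A, A = x1 - x0 + 1 := ⟨_, rfl⟩
  obtain ⟨B, hB⟩ : ∃ B, B = y1 - y0 + β := ⟨_, rfl⟩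
  have hi : ∀ s : ℝ, HasDerivAt (fun s : ℝ => s) 1 s := fun s => hasDerivAt_id' s
  have hp : ∀ (n : ℕ) (s : ℝ), HasDerivAt (fun s : ℝ => s ^ n) (n * s ^ (n - 1)) s :=
    fun n s => hasDerivAt_pow n s
  have := Lset_mem (x := fun s => x0 + A * s ^ 1 - s ^ 2)
    (y := fun s => y0 + B * s ^ 1 + (- 3 * β) * s ^ 2 + (2 * β) * s ^ 3)
    (t := fun s => t0 + (2 * (y0 * A - x0 * B)) * s ^ 1 + (-2 * y0 + 6 * β * x0) * s ^ 2
      + (2 / 3 * (3 * β * A - B - 6 * β * x0)) * s ^ 3 + (- 2 * β * A) * s ^ 4 + (4 * β / 5) * s ^ 5)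
    (a := fun s => A - 2 * s) (b := fun s => B - 6 * β * s + 6 * β * s ^ 2)
    (fun s => by
      refine (((hp 1 s).const_mul A).const_add x0 |>.sub (hp 2 s)).congr_deriv ?_
      norm_num)
    (fun s => by
      refine ((((hp 1 s).const_mul B).const_add y0 |>.add ((hp 2 s).const_mul (-3 * β))).add
        ((hp 3 s).const_mul (2 * β))).congr_deriv ?_
      norm_num; ring)
    (fun s => by
      refine ((((((hp 1 s).const_mul _).const_add t0 |>.add ((hp 2 s).const_mul _)).add
        ((hp 3 s).const_mul _)).add ((hp 4 s).const_mul _)).add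
        ((hp 5 s).const_mul _)).congr_deriv ?_
      norm_num; ring)
    (by fun_prop) (by fun_prop)
  refine ⟨∫ s in (0:ℝ)..1, Real.sqrt ((A - 2 * s) ^ 2 + (B - 6 * β * s + 6 * β * s ^ 2) ^ 2), ?_⟩
  · convert this using 2
    · norm_num
    · norm_num
      refine ⟨?_, ?_, ?_⟩
      · rw [hA]; ring
      · rw [hB]; ring
      · rw [hβ, hA, hB]; ring

theorem dH_geo_le {q s : ℝ} (hq : 0 < q) (hs : s / q ≤ Real.pi) :
    dH (geoq q s) (2 * q, 0, 0) ≤ (Real.pi - s / q) * q := by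
  have hg : geoq q s = (q * (1 - Real.cos (s / q)), q * Real.sin (s / q),
    2 * q ^ 2 * (s / q - Real.pi - Real.sin (s / q))) := rfl
  set θ := s / q
  obtain ⟨w, hw⟩ : ∃ w, w = Real.pi - θ := ⟨_, rfl⟩
  have hθ : ∀ r : ℝ, HasDerivAt (fun r => θ + w * r) w r := fun r => by
    simpa using ((hasDerivAt_id' r).const_mul w).const_add θ
  have := Lset_mem (x := fun r => q * (1 - Real.cos (θ + w * r)))
    (y := fun r => q * Real.sin (θ + w * r))
    (t := fun r => 2 * q ^ 2 * (θ + w * r - Real.pi - Real.sin (θ + w * r)))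
    (a := fun r => q * (w * Real.sin (θ + w * r)))
    (b := fun r => q * (w * Real.cos (θ + w * r)))
    (fun r => by
      refine (((hθ r).cos.const_sub 1).const_mul q).congr_deriv ?_
      ring)
    (fun r => by
      refine ((hθ r).sin.const_mul q).congr_deriv ?_
      ring)
    (fun r => by
      refine ((((hθ r).sub_const Real.pi).sub (hθ r).sin).const_mul (2 * q ^ 2)).congr_deriv ?_
      have := Real.sin_sq_add_cos_sq (θ + w * r)
      linear_combination (-2 * q ^ 2 * w) * this)
    (by fun_prop) (by fun_prop)
  have e : ∀ r : ℝ, Real.sqrt ((q * (w * Real.sin (θ + w * r))) ^ 2 +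
      (q * (w * Real.cos (θ + w * r))) ^ 2) = w * q := fun r => by
    rw [show (q * (w * Real.sin (θ + w * r))) ^ 2 + (q * (w * Real.cos (θ + w * r))) ^ 2 =
      (w * q) ^ 2 * (Real.sin (θ + w * r) ^ 2 + Real.cos (θ + w * r) ^ 2) by ring,
      Real.sin_sq_add_cos_sq, mul_one, Real.sqrt_sq]
    exact mul_nonneg (by linarith) hq.le
  simp only [e] at this
  have hπ : θ + w = Real.pi := by rw [hw]; ring
  simp only [mul_zero, add_zero, mul_one, hπ, Real.cos_pi, Real.sin_pi, sub_self,
    intervalIntegral.integral_const, sub_zero, one_smul] at this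
  rw [← hw]
  have e2 : ((2 * q, 0, 0) : H) = (q * (1 - -1), 0, 0) := by norm_num; ring
  rw [hg, e2]
  exact csInf_le (Lset_bdd _ _) this

theorem main_aux {h q θ : ℝ} (hh : 0 < h) (hh1 : h ≤ 1 / 100) (hq : 0 < q) (hθ : h ≤ θ)
    (hθ1 : θ < Real.pi) {γ : ℝ → H} {a b : ℝ → ℝ} {K : NNReal} (hγ : LipschitzWith K γ)
    (h0 : γ 0 = (q * (1 - Real.cos θ), q * Real.sin θ,
      2 * q ^ 2 * (θ - Real.pi - Real.sin θ)))
    (hd : ∀ᵐ s ∂volume, s ∈ Set.Icc (0:ℝ) 1 →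
      HasDerivAt γ (a s, b s, 2 * (γ s).2.1 * a s - 2 * (γ s).1 * b s) s)
    (hi : IntervalIntegrable (fun s => Real.sqrt (a s ^ 2 + b s ^ 2)) volume 0 1)
    (hL : (∫ s in (0:ℝ)..1, Real.sqrt (a s ^ 2 + b s ^ 2)) <
      (1 + (h ^ 4) ^ 2) * ((Real.pi - θ) * q)) (h1 : 0 < (γ 1).2.2) :
    |q⁻¹ * (γ 1).1 - 2| ≤ 2000 * h ^ 2 ∧ |q⁻¹ * (γ 1).2.1| ≤ 2000 * h ^ 2 := by
  set σ : ℝ := (h ^ 4) ^ 2 with hσ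
  have hσ0 : 0 < 1 + σ := by positivity
  obtain ⟨p0, hp⟩ : ∃ p0, p0 = (Real.pi - θ) / 2 := ⟨_, rfl⟩
  have hθp : θ = Real.pi - 2 * p0 := by rw [hp]; ring
  have hpi := Real.pi_lt_d2
  have hpp := Real.pi_pos
  have hcos : Real.cos p0 = Real.sin (θ / 2) := by
    rw [← Real.cos_pi_div_two_sub, hp]; congr 1; ring
  have hc : h / 3.2 ≤ Real.cos p0 := by
    rw [hcos]
    refine le_trans ?_ (Real.mul_le_sin (x := θ / 2) (by linarith) (by linarith))
    rw [show 2 / Real.pi * (θ / 2) = θ / Real.pi by ring]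
    exact div_le_div₀ (by linarith) hθ hpp (by norm_num at hpi ⊢; linarith)
  have hcs := Real.sin_sq_add_cos_sq p0
  set u : ℝ → ℝ := fun s => q⁻¹ * Real.sqrt (a s ^ 2 + b s ^ 2) with hu
  have hu0 : ∀ s, 0 ≤ u s := fun s => mul_nonneg (inv_nonneg.2 hq.le) (Real.sqrt_nonneg _)
  have hui : IntervalIntegrable u volume 0 1 := hi.const_mul _
  have hUac : ACI (fun r => ∫ s in (0:ℝ)..r, u s) 0 1 :=
    hui.absolutelyContinuousOnInterval_intervalIntegral (by simp)
  have hUd := hui.ae_hasDerivAt_integral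
  have hU1 : (∫ s in (0:ℝ)..1, u s) < (1 + σ) * (2 * p0) := by
    simp only [hu]
    rw [intervalIntegral.integral_const_mul, inv_mul_lt_iff₀ hq, hp]
    linarith
  have hq2 : (q⁻¹) ^ 2 * q ^ 2 = 1 := by field_simp
  have hq1 : q⁻¹ * q = 1 := by field_simp
  have hCrv : Crv (fun s => q⁻¹ * (γ s).1) (fun s => q⁻¹ * (γ s).2.1)
      (fun s => (q⁻¹) ^ 2 * (γ s).2.2) (fun r => 2 * p0 - (1 + σ)⁻¹ * ∫ s in (0:ℝ)..r, u s)
      (fun s => q⁻¹ * a s) (fun s => q⁻¹ * b s) (fun s => (1 + σ)⁻¹ * u s) σ := by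
    have l2 := LipschitzWith.prod_snd.comp hγ
    refine ⟨?_, ?_, ?_, ?_, ?_, ?_⟩
    · exact ((LipschitzWith.prod_fst.comp hγ).lipschitzOnWith
        (s := Set.uIcc 0 1)).absolutelyContinuousOnInterval.const_mul q⁻¹
    · exact ((LipschitzWith.prod_fst.comp l2).lipschitzOnWith
        (s := Set.uIcc 0 1)).absolutelyContinuousOnInterval.const_mul q⁻¹
    · exact ((LipschitzWith.prod_snd.comp l2).lipschitzOnWith
        (s := Set.uIcc 0 1)).absolutelyContinuousOnInterval.const_mul _
    · exact (aci_const (2 * p0) 0 1).sub (hUac.const_mul _)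
    · filter_upwards [hd, hUd] with s h2 h3 hs
      have h4 := h2 hs
      have h5 := h3 (by rwa [Set.uIcc_of_le zero_le_one]) 0 (by simp)
      have dx : HasDerivAt (fun s => (γ s).1) (a s) s := h4.fst
      have dyt := h4.snd
      have dy : HasDerivAt (fun s => (γ s).2.1) (b s) s := dyt.fst
      have dt : HasDerivAt (fun s => (γ s).2.2) (2 * (γ s).2.1 * a s - 2 * (γ s).1 * b s) s :=
        dyt.snd
      refine ⟨dx.const_mul _, dy.const_mul _, ?_, ?_, ?_, ?_⟩
      · exact (dt.const_mul ((q⁻¹) ^ 2)).congr_deriv (by ring)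
      · exact (h5.const_mul ((1 + σ)⁻¹)).const_sub (2 * p0)
      · exact mul_nonneg (inv_nonneg.2 hσ0.le) (hu0 s)
      · rw [mul_inv_cancel_left₀ hσ0.ne']
        simp only [hu]
        rw [show (q⁻¹ * a s) ^ 2 + (q⁻¹ * b s) ^ 2 = (q⁻¹) ^ 2 * (a s ^ 2 + b s ^ 2) by ring,
          Real.sqrt_mul (by positivity), Real.sqrt_sq (by positivity)]
    · intro r hr
      have hm : (∫ s in (0:ℝ)..r, u s) ≤ ∫ s in (0:ℝ)..1, u s :=
        intervalIntegral.integral_mono_interval le_rfl hr.1 hr.2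
          (Filter.Eventually.of_forall hu0) hui
      have : (1 + σ)⁻¹ * (∫ s in (0:ℝ)..r, u s) < 2 * p0 := by
        rw [inv_mul_lt_iff₀ hσ0]; linarith
      linarith
  have hc2 : Real.cos θ = 1 - 2 * Real.cos p0 ^ 2 := by
    rw [hθp, Real.cos_pi_sub, Real.cos_two_mul]; ring
  have hs2 : Real.sin θ = 2 * Real.sin p0 * Real.cos p0 := by
    rw [hθp, Real.sin_pi_sub, Real.sin_two_mul]
  refine core hCrv hh hh1 ?_ (by linarith : 0 < p0) (by linarith) hc ?_ ?_ ?_ ?_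
  · positivity
  · simp
  · simp only [h0, hc2]; linear_combination (2 * Real.cos p0 ^ 2) * hq1
  · simp only [h0, hs2]; linear_combination (2 * Real.sin p0 * Real.cos p0) * hq1
  · simp only [h0, hs2]; rw [hθp]
    linear_combination (- 4 * (p0 + Real.sin p0 * Real.cos p0)) * hq2

/-- Proposition, part 2: projection of the enlarged ball.
There are universal `σ₀ > 0` and `C₀ > 0` such that for all `σ < σ₀`, `q > 0`
and `s` with `σ^{1/8} ≤ s/q ≤ π − σ^{1/16}`, setting `P = γ(s)`,
`Q = γ(πq) = (2q,0,0)` and `Π₁(z;t) = z`, one has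
`Π₁(B(P, (1+σ)d(P,Q)) ∩ {t > 0}) ⊆ {z : |z − 2q| ≤ C₀ q σ^{1/4}}`. -/
theorem statement16 :
    ∃ σ₀ > (0:ℝ), ∃ C₀ > (0:ℝ), ∀ σ : ℝ, 0 < σ → σ < σ₀ →
      ∀ q : ℝ, 0 < q → ∀ s : ℝ,
        σ ^ ((1:ℝ)/8) ≤ s / q → s / q ≤ Real.pi - σ ^ ((1:ℝ)/16) →
        (fun p : H => (p.1, p.2.1)) ''
            ({Q' : H | dH (geoq q s) Q' < (1 + σ) * dH (geoq q s) ((2 * q, 0, 0) : H)} ∩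
              {p : H | 0 < p.2.2})
          ⊆ {z : ℝ × ℝ |
              Real.sqrt ((z.1 - 2 * q) ^ 2 + z.2 ^ 2) ≤ C₀ * q * σ ^ ((1:ℝ)/4)} := by
  refine ⟨((1 / 100) ^ 4) ^ 2, by positivity, 4000, by norm_num, ?_⟩
  intro σ hσ hσ0 q hq s hs1 hs2
  rintro _ ⟨Q', ⟨hQ1, hQ2⟩, rfl⟩
  obtain ⟨h, hh⟩ : ∃ h, h = σ ^ ((1:ℝ) / 8) := ⟨_, rfl⟩
  have hh0 : 0 < h := by rw [hh]; exact Real.rpow_pos_of_pos hσ _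
  have hσh : σ = (h ^ 4) ^ 2 := by
    rw [← pow_mul, hh, ← Real.rpow_natCast, ← Real.rpow_mul hσ.le]
    norm_num
  have hh2 : σ ^ ((1:ℝ) / 4) = h ^ 2 := by
    rw [hh, ← Real.rpow_natCast, ← Real.rpow_mul hσ.le]
    norm_num
  have hh1 : h ≤ 1 / 100 := by
    rw [hσh, ← pow_mul, ← pow_mul] at hσ0
    exact (lt_of_pow_lt_pow_left₀ _ (by norm_num) hσ0).le
  have hpos : 0 < σ ^ ((1:ℝ) / 16) := Real.rpow_pos_of_pos hσ _
  have hθ1 : s / q < Real.pi := by linarith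
  have hQ1' : dH (geoq q s) Q' < (1 + σ) * ((Real.pi - s / q) * q) :=
    lt_of_lt_of_le hQ1 (mul_le_mul_of_nonneg_left (dH_geo_le hq hθ1.le) (by linarith))
  obtain ⟨L, ⟨γ, a, b, K, hγ, h0, h1, hd, hi, rfl⟩, hL⟩ :=
    exists_lt_of_csInf_lt (Lset_nonempty (geoq q s) Q') hQ1'
  rw [← hh] at hs1
  rw [hσh] at hL
  obtain ⟨r1, r2⟩ := main_aux hh0 hh1 hq hs1 hθ1 hγ h0 hd hi hL (by rw [h1]; exact hQ2)
  rw [h1] at r1 r2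
  have e1 : |Q'.1 - 2 * q| ≤ 2000 * h ^ 2 * q := by
    rw [show Q'.1 - 2 * q = (q⁻¹ * Q'.1 - 2) * q by field_simp, abs_mul, abs_of_pos hq]
    exact mul_le_mul_of_nonneg_right r1 hq.le
  have e2 : |Q'.2.1| ≤ 2000 * h ^ 2 * q := by
    rw [show Q'.2.1 = (q⁻¹ * Q'.2.1) * q by field_simp, abs_mul, abs_of_pos hq]
    exact mul_le_mul_of_nonneg_right r2 hq.le
  show Real.sqrt ((Q'.1 - 2 * q) ^ 2 + Q'.2.1 ^ 2) ≤ 4000 * q * σ ^ ((1:ℝ)/4)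
  rw [hh2, Real.sqrt_le_left (by positivity), ← sq_abs (Q'.1 - 2 * q), ← sq_abs Q'.2.1]
  nlinarith [abs_nonneg (Q'.1 - 2 * q), abs_nonneg Q'.2.1]
end
end

section
/- There exist ε₀ > 0 and C > 0 such that if f = (ζ;τ) : ℍ → ℍ is (1+ε)-biLipschitz with ε < ε₀ and f(O) = O, then for all t ∈ ℝ: |ζ(0,0,t)| ≤ C ε^{1/16} |t|^{1/2} and | |t| − |τ(0,0,t)| | ≤ C ε^{1/16} |t|. -/
noncomputable section

open MeasureTheory

/-- Membership in the set of lengths of admissible curves. -/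
def IsCurve (P Q : H) (L : ℝ) : Prop :=
  ∃ (γ : ℝ → H) (a b : ℝ → ℝ) (K : NNReal),
    LipschitzWith K γ ∧ γ 0 = P ∧ γ 1 = Q ∧
    (∀ᵐ s ∂volume, s ∈ Set.Icc (0:ℝ) 1 →
      HasDerivAt γ (a s, b s, 2 * (γ s).2.1 * a s - 2 * (γ s).1 * b s) s) ∧
    IntervalIntegrable (fun s => Real.sqrt (a s ^ 2 + b s ^ 2)) volume 0 1 ∧
    L = ∫ s in (0:ℝ)..1, Real.sqrt (a s ^ 2 + b s ^ 2)

lemma dH_eq (P Q : H) : dH P Q = sInf {L | IsCurve P Q L} := rfl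

lemma IsCurve.nonneg {P Q : H} {L : ℝ} (h : IsCurve P Q L) : 0 ≤ L := by
  obtain ⟨γ, a, b, K, h1, h2, h3, h4, h5, rfl⟩ := h
  exact intervalIntegral.integral_nonneg (by norm_num) (fun s _ => Real.sqrt_nonneg _)

lemma dH_nonneg (P Q : H) : 0 ≤ dH P Q := by
  rw [dH_eq]
  exact Real.sInf_nonneg (fun L hL => IsCurve.nonneg hL)

lemma dH_le {P Q : H} {L : ℝ} (h : IsCurve P Q L) : dH P Q ≤ L := by
  rw [dH_eq]
  exact csInf_le ⟨0, fun L hL => IsCurve.nonneg hL⟩ h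

lemma hasDerivAt_parts {γ : ℝ → H} {u v w s : ℝ} (h : HasDerivAt γ (u, v, w) s) :
    HasDerivAt (fun s => (γ s).1) u s ∧ HasDerivAt (fun s => (γ s).2.1) v s ∧
      HasDerivAt (fun s => (γ s).2.2) w s := by
  have h' := h.hasFDerivAt
  refine ⟨?_, ?_, ?_⟩
  · simpa using h'.fst.hasDerivAt
  · simpa using h'.snd.fst.hasDerivAt
  · simpa using h'.snd.snd.hasDerivAt

lemma lip_parts {γ : ℝ → H} {K : NNReal} (h : LipschitzWith K γ) :
    LipschitzWith K (fun s => (γ s).1) ∧ LipschitzWith K (fun s => (γ s).2.1) ∧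
      LipschitzWith K (fun s => (γ s).2.2) := by
  refine ⟨?_, ?_, ?_⟩
  · simpa [Function.comp_def] using LipschitzWith.prod_fst.comp h
  · simpa [Function.comp_def] using LipschitzWith.prod_fst.comp (LipschitzWith.prod_snd.comp h)
  · simpa [Function.comp_def] using LipschitzWith.prod_snd.comp (LipschitzWith.prod_snd.comp h)

lemma lip_const_mul {f : ℝ → ℝ} {K : NNReal} (c : ℝ) (h : LipschitzWith K f) :
    LipschitzWith (‖c‖₊ * K) (fun s => c * f s) := by
  simpa [Function.comp_def] using (lipschitzWith_smul c).comp h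

lemma IsCurve.translate {P Q : H} {L : ℝ} (g : H) (h : IsCurve P Q L) :
    IsCurve (Hmul g P) (Hmul g Q) L := by
  obtain ⟨γ, a, b, K, h1, rfl, rfl, h4, h5, rfl⟩ := h
  obtain ⟨l1, l2, l3⟩ := lip_parts h1
  have l4 := (l3.add (lip_const_mul (2 * g.2.1) l1)).add (lip_const_mul (-(2 * g.1)) l2)
  have l1' := (LipschitzWith.const g.1).add l1
  have l2' := (LipschitzWith.const g.2.1).add l2
  have l4' := (LipschitzWith.const g.2.2).add l4
  have hl : ∃ K', LipschitzWith K' (fun s => Hmul g (γ s)) := by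
    have e : (fun s => Hmul g (γ s)) = fun x => (g.1 + (γ x).1, g.2.1 + (γ x).2.1,
        g.2.2 + ((γ x).2.2 + 2 * g.2.1 * (γ x).1 + -(2 * g.1) * (γ x).2.1)) := by
      ext s
      · rfl
      · rfl
      · simp only [Hmul]; ring
    rw [e]
    exact ⟨_, l1'.prodMk (l2'.prodMk l4')⟩
  obtain ⟨K', hK'⟩ := hl
  refine ⟨fun s => Hmul g (γ s), a, b, K', hK', rfl, rfl, ?_, h5, rfl⟩
  filter_upwards [h4] with s hs hs'
  obtain ⟨d1, d2, d3⟩ := hasDerivAt_parts (hs hs')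
  have e3 : HasDerivAt (fun s => g.2.2 + (γ s).2.2 + 2 * ((γ s).1 * g.2.1 - g.1 * (γ s).2.1))
    (2 * (γ s).2.1 * a s - 2 * (γ s).1 * b s + 2 * (a s * g.2.1 - g.1 * b s)) s :=
    (d3.const_add g.2.2).add (((d1.mul_const g.2.1).sub (d2.const_mul g.1)).const_mul 2)
  have := (d1.const_add g.1).prodMk ((d2.const_add g.2.1).prodMk e3)
  unfold Hmul
  refine HasDerivAt.congr_deriv this ?_
  ext
  · rfl
  · rfl
  · simp only; ring

lemma Hmul_inv_cancel (P Q : H) : Hmul P (Hmul (Hinv P) Q) = Q := by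
  ext <;> simp only [Hmul, Hinv] <;> ring

lemma Hinv_mul (P : H) : Hmul (Hinv P) P = HO := by
  ext <;> simp only [Hmul, Hinv, HO] <;> ring

lemma Hmul_O (P : H) : Hmul P HO = P := by
  ext <;> simp only [Hmul, HO] <;> ring

lemma dH_left (P Q : H) : dH P Q = dH HO (Hmul (Hinv P) Q) := by
  rw [dH_eq, dH_eq]
  congr 1
  ext L
  constructor
  · intro h
    have := IsCurve.translate (Hinv P) h
    rwa [Hinv_mul] at this
  · intro h
    have := IsCurve.translate P h
    rwa [Hmul_O, Hmul_inv_cancel] at this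

lemma isCurve_line (p q : ℝ) : IsCurve HO (p, q, 0) (Real.sqrt (p ^ 2 + q ^ 2)) := by
  have l1 := lip_const_mul p LipschitzWith.id
  have l2 := lip_const_mul q LipschitzWith.id
  refine ⟨fun s => (p * s, q * s, 0), fun _ => p, fun _ => q, _,
    l1.prodMk (l2.prodMk (LipschitzWith.const 0)), ?_, ?_, ?_, ?_, ?_⟩
  · simp [HO]
  · simp
  · refine Filter.Eventually.of_forall fun s _ => ?_
    have d1 : HasDerivAt (fun s => p * s) p s := by simpa using (hasDerivAt_id s).const_mul p
    have d2 : HasDerivAt (fun s => q * s) q s := by simpa using (hasDerivAt_id s).const_mul q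
    convert d1.prodMk (d2.prodMk (hasDerivAt_const s (0:ℝ))) using 3
    simp only; ring
  · simp
  · simp

lemma isCurve_arc (v w κ : ℝ) (hκ : κ ≠ 0) :
    IsCurve HO ((v * Real.sin κ + w * (1 - Real.cos κ)) / κ,
      (w * Real.sin κ - v * (1 - Real.cos κ)) / κ,
      2 * (v ^ 2 + w ^ 2) * (κ - Real.sin κ) / κ ^ 2) (Real.sqrt (v ^ 2 + w ^ 2)) := by
  have lid := lip_const_mul κ LipschitzWith.id
  have ls : LipschitzWith _ (fun s => Real.sin (κ * s)) := Real.lipschitzWith_sin.comp lid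
  have lc : LipschitzWith _ (fun s => Real.cos (κ * s)) := Real.lipschitzWith_cos.comp lid
  have l1 := (LipschitzWith.const (w / κ)).add
    ((lip_const_mul (v / κ) ls).add (lip_const_mul (-w / κ) lc))
  have l2 := (LipschitzWith.const (-v / κ)).add
    ((lip_const_mul (w / κ) ls).add (lip_const_mul (v / κ) lc))
  have l3 := (lip_const_mul (2 * (v ^ 2 + w ^ 2) / κ ^ 2) lid).add
    (lip_const_mul (-(2 * (v ^ 2 + w ^ 2) / κ ^ 2)) ls)
  refine ⟨_, fun s => v * Real.cos (κ * s) + w * Real.sin (κ * s),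
    fun s => w * Real.cos (κ * s) - v * Real.sin (κ * s), _,
    l1.prodMk (l2.prodMk l3), ?_, ?_, ?_, ?_, ?_⟩
  · ext <;> simp [HO] <;> ring
  · ext <;> simp <;> field_simp <;> ring
  · refine Filter.Eventually.of_forall fun s _ => ?_
    have did : HasDerivAt (fun s => κ * id s) κ s := by simpa using (hasDerivAt_id s).const_mul κ
    have ds := did.sin
    have dc := did.cos
    have d1 := (hasDerivAt_const s (w / κ)).add ((ds.const_mul (v / κ)).add (dc.const_mul (-w / κ)))
    have d2 := (hasDerivAt_const s (-v / κ)).add ((ds.const_mul (w / κ)).add (dc.const_mul (v / κ)))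
    have d3 := (did.const_mul (2 * (v ^ 2 + w ^ 2) / κ ^ 2)).add
      (ds.const_mul (-(2 * (v ^ 2 + w ^ 2) / κ ^ 2)))
    refine HasDerivAt.congr_deriv (d1.prodMk (d2.prodMk d3)) ?_
    have := Real.sin_sq_add_cos_sq (κ * s)
    ext
    · simp; field_simp
    · simp; field_simp; ring
    · simp; field_simp
      linear_combination (-(v ^ 2 + w ^ 2)) * this
  · apply Continuous.intervalIntegrable
    fun_prop
  · have : ∀ s : ℝ, (v * Real.cos (κ * s) + w * Real.sin (κ * s)) ^ 2 +
        (w * Real.cos (κ * s) - v * Real.sin (κ * s)) ^ 2 = v ^ 2 + w ^ 2 := by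
      intro s
      linear_combination (v ^ 2 + w ^ 2) * Real.sin_sq_add_cos_sq (κ * s)
    simp [this]

lemma ac_comp {f g : ℝ → ℝ} {K : NNReal} {t : Set ℝ} (hg : LipschitzOnWith K g t)
    (hf : AbsolutelyContinuousOnInterval f 0 1) (hm : Set.MapsTo f (Set.uIcc 0 1) t) :
    AbsolutelyContinuousOnInterval (fun s => g (f s)) 0 1 := by
  rw [absolutelyContinuousOnInterval_iff] at hf ⊢
  intro ε hε
  obtain ⟨δ, hδ, h⟩ := hf (ε / (K + 1)) (by positivity)
  refine ⟨δ, hδ, fun E hE hs => ?_⟩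
  have h1 := h E hE hs
  calc _ ≤ ∑ i ∈ Finset.range E.1, K * dist (f (E.2 i).1) (f (E.2 i).2) := by
        apply Finset.sum_le_sum
        intro i hi
        exact hg.dist_le_mul _ (hm (hE.1 i hi).1) _ (hm (hE.1 i hi).2)
    _ = K * ∑ i ∈ Finset.range E.1, dist (f (E.2 i).1) (f (E.2 i).2) := by
        rw [Finset.mul_sum]
    _ ≤ K * (ε / (K + 1)) := by gcongr
    _ < (K + 1) * (ε / (K + 1)) := by gcongr; linarith
    _ = ε := by field_simp

lemma pointwise_ineq {n a b x y c k σ : ℝ} (hn : 0 ≤ n) (hn2 : n ^ 2 = a ^ 2 + b ^ 2)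
    (hσ : σ ^ 2 = 1) :
    0 ≤ n + n * (k ^ 2 + c ^ 2) * (x ^ 2 + y ^ 2) - 2 * c * (x * a + y * b)
      - σ * k * (2 * y * a - 2 * x * b) := by
  rcases hn.eq_or_lt with h | h
  · subst h
    have ha : a = 0 := by nlinarith [sq_nonneg a, sq_nonneg b]
    have hb : b = 0 := by nlinarith [sq_nonneg a, sq_nonneg b]
    subst ha; subst hb; simp
  · have key : n * (n + n * (k ^ 2 + c ^ 2) * (x ^ 2 + y ^ 2) - 2 * c * (x * a + y * b)
      - σ * k * (2 * y * a - 2 * x * b)) = (a - n * (c * x + σ * k * y)) ^ 2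
        + (b - n * (c * y - σ * k * x)) ^ 2 := by
      linear_combination hn2 - n ^ 2 * k ^ 2 * (x ^ 2 + y ^ 2) * hσ
    by_contra hc
    push Not at hc
    have := mul_neg_of_pos_of_neg h hc
    rw [key] at this
    nlinarith [sq_nonneg (a - n * (c * x + σ * k * y)), sq_nonneg (b - n * (c * y - σ * k * x))]

lemma lower_curve {p q t L φ σ Λ : ℝ} (h : IsCurve HO (p, q, t) L) (h0 : 0 < φ)
    (hπ : φ < Real.pi) (hσ : σ ^ 2 = 1) (hΛ : L < Λ) :
    σ * φ * t + (p ^ 2 + q ^ 2) * (φ * Real.cos φ / Real.sin φ) ≤ Λ ^ 2 := by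
  have hL0 := h.nonneg
  have hΛ0 : 0 < Λ := by linarith
  obtain ⟨γ, a, b, K, h1, h2, h3, h4, h5, h6⟩ := h
  obtain ⟨l1, l2, l3⟩ := lip_parts h1
  set n : ℝ → ℝ := fun s => Real.sqrt (a s ^ 2 + b s ^ 2) with hn
  set ℓ : ℝ → ℝ := fun s => ∫ r in (0:ℝ)..s, n r with hℓ
  set k := φ / Λ with hk
  have hk0 : 0 < k := by positivity
  have hkΛ : k * Λ = φ := by rw [hk]; field_simp
  set θ : ℝ → ℝ := fun r => φ - k * (L - r) with hθ
  have hθr : ∀ r ∈ Set.Icc 0 L, 0 < θ r ∧ θ r < Real.pi := by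
    intro r hr
    constructor
    · simp only [hθ]
      nlinarith [hr.1, hr.2]
    · simp only [hθ]
      nlinarith [hr.1, hr.2]
  have hsin : ∀ r ∈ Set.Icc 0 L, Real.sin (θ r) ≠ 0 := fun r hr =>
    (Real.sin_pos_of_pos_of_lt_pi (hθr r hr).1 (hθr r hr).2).ne'
  set g : ℝ → ℝ := fun r => k * Real.cos (θ r) / Real.sin (θ r) with hg
  have hgc : ContDiffOn ℝ 1 g (Set.Icc 0 L) := by
    apply ContDiffOn.div
    · simp only [hθ]; fun_prop
    · simp only [hθ]; fun_prop
    · exact hsin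
  obtain ⟨Kg, hKg⟩ := hgc.exists_lipschitzOnWith (by decide) (convex_Icc _ _) isCompact_Icc
  have hℓac : AbsolutelyContinuousOnInterval ℓ 0 1 :=
    h5.absolutelyContinuousOnInterval_intervalIntegral (by simp)
  have hn0 : ∀ s, 0 ≤ n s := fun s => Real.sqrt_nonneg _
  have hℓ1 : ℓ 1 = L := h6.symm
  have hℓ0 : ℓ 0 = 0 := by simp [hℓ]
  have hmaps : Set.MapsTo ℓ (Set.uIcc 0 1) (Set.Icc 0 L) := by
    intro s hs
    rw [Set.uIcc_of_le (by norm_num)] at hs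
    constructor
    · exact intervalIntegral.integral_nonneg hs.1 (fun r _ => hn0 r)
    · rw [← hℓ1]
      exact intervalIntegral.integral_mono_interval le_rfl hs.1 hs.2
        (Filter.Eventually.of_forall fun r => hn0 r) h5
  have hcac := ac_comp hKg hℓac hmaps
  have xac : AbsolutelyContinuousOnInterval (fun s => (γ s).1) 0 1 :=
    (l1.lipschitzOnWith (s := Set.uIcc 0 1)).absolutelyContinuousOnInterval
  have yac : AbsolutelyContinuousOnInterval (fun s => (γ s).2.1) 0 1 :=
    (l2.lipschitzOnWith (s := Set.uIcc 0 1)).absolutelyContinuousOnInterval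
  have tac : AbsolutelyContinuousOnInterval (fun s => (γ s).2.2) 0 1 :=
    (l3.lipschitzOnWith (s := Set.uIcc 0 1)).absolutelyContinuousOnInterval
  set F : ℝ → ℝ := fun s => ℓ s - σ * k * (γ s).2.2 - g (ℓ s) *
    ((γ s).1 * (γ s).1 + (γ s).2.1 * (γ s).2.1) with hF
  have Fac : AbsolutelyContinuousOnInterval F 0 1 :=
    (hℓac.sub (tac.const_mul (σ * k))).sub (hcac.mul ((xac.mul xac).add (yac.mul yac)))
  have hint := Fac.integral_deriv_eq_sub
  have hnonneg : 0 ≤ ∫ s in (0:ℝ)..1, deriv F s := by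
    apply intervalIntegral.integral_nonneg_of_ae_restrict (by norm_num)
    rw [Filter.EventuallyLE, ae_restrict_iff' measurableSet_Icc]
    filter_upwards [h4, h5.ae_hasDerivAt_integral] with s hs hs2 hs3
    have hs4 : s ∈ Set.uIcc (0:ℝ) 1 := by rwa [Set.uIcc_of_le (by norm_num)]
    obtain ⟨d1, d2, d3⟩ := hasDerivAt_parts (hs hs3)
    have dℓ : HasDerivAt ℓ (n s) s := hs2 hs4 0 (by simp)
    have hS := hsin _ (hmaps hs4)
    have dθ : HasDerivAt (fun s => θ (ℓ s)) (k * n s) s := by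
      simpa [hθ] using ((dℓ.const_sub L).const_mul k).const_sub φ
    have dg : HasDerivAt (fun s => g (ℓ s)) (-(n s * (k ^ 2 + g (ℓ s) ^ 2))) s := by
      have := (dθ.cos.const_mul k).div dθ.sin hS
      refine HasDerivAt.congr_deriv this ?_
      simp only [hg]
      field_simp
      ring
    have dF := (dℓ.sub (d3.const_mul (σ * k))).sub (dg.mul ((d1.mul d1).add (d2.mul d2)))
    have e : deriv F s = _ := HasDerivAt.deriv dF
    rw [e]
    have := pointwise_ineq (n := n s) (a := a s) (b := b s) (x := (γ s).1) (y := (γ s).2.1)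
      (c := g (ℓ s)) (k := k) (σ := σ) (hn0 s) (Real.sq_sqrt (by positivity)) hσ
    simp only [Pi.zero_apply, Pi.add_apply, Pi.mul_apply]
    linarith
  rw [hint] at hnonneg
  have hθL : θ L = φ := by simp [hθ]
  simp only [hF, hℓ1, hℓ0, h2, h3, HO, hg, hθL] at hnonneg
  have hfin : 0 ≤ Λ * (L - σ * k * t - k * Real.cos φ / Real.sin φ * (p * p + q * q)) := by
    apply mul_nonneg hΛ0.le
    linarith
  have e2 : Λ * (L - σ * k * t - k * Real.cos φ / Real.sin φ * (p * p + q * q)) =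
      Λ * L - (σ * φ * t + (p ^ 2 + q ^ 2) * (φ * Real.cos φ / Real.sin φ)) := by
    rw [← hkΛ]; ring
  rw [e2] at hfin
  nlinarith

lemma isCurve_phi {p q t φ : ℝ} (hφ : φ ≠ 0) (hs : Real.sin φ ≠ 0)
    (h : (p ^ 2 + q ^ 2) * (φ - Real.sin φ * Real.cos φ) = t * Real.sin φ ^ 2) :
    IsCurve HO (p, q, t) (Real.sqrt ((φ / Real.sin φ) ^ 2 * (p ^ 2 + q ^ 2))) := by
  have := isCurve_arc (φ / Real.sin φ * (p * Real.cos φ - q * Real.sin φ))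
    (φ / Real.sin φ * (q * Real.cos φ + p * Real.sin φ)) (2 * φ) (by simpa using hφ)
  have hc := Real.sin_sq_add_cos_sq φ
  have hc2 : Real.cos (2 * φ) = 1 - 2 * Real.sin φ ^ 2 := by
    rw [Real.cos_two_mul]; linear_combination 2 * hc
  have e : (φ / Real.sin φ * (p * Real.cos φ - q * Real.sin φ)) ^ 2 +
    (φ / Real.sin φ * (q * Real.cos φ + p * Real.sin φ)) ^ 2 =
      (φ / Real.sin φ) ^ 2 * (p ^ 2 + q ^ 2) := by
    linear_combination ((φ / Real.sin φ) ^ 2 * (p ^ 2 + q ^ 2)) * hc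
  rw [e, Real.sin_two_mul, hc2] at this
  convert this using 2
  · field_simp
    linear_combination (-2 * p * Real.sin φ) * hc
  · congr 1
    · field_simp
      linear_combination (-2 * q * Real.sin φ) * hc
    · field_simp
      linear_combination -h

lemma isCurve_vert {t : ℝ} (ht : t ≠ 0) :
    IsCurve HO (0, 0, t) (Real.sqrt (Real.pi * |t|)) := by
  have hpi := Real.pi_pos
  rcases lt_or_gt_of_ne ht with h | h
  · have := isCurve_arc (Real.sqrt (Real.pi * |t|)) 0 (-(2 * Real.pi)) (by simp [hpi.ne'])
    have e : Real.sqrt (Real.pi * |t|) ^ 2 + 0 ^ 2 = Real.pi * |t| := by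
      rw [Real.sq_sqrt (by positivity)]; ring
    rw [e, Real.sin_neg, Real.cos_neg, Real.sin_two_pi, Real.cos_two_pi, abs_of_neg h] at this
    rw [abs_of_neg h]
    convert this using 2
    · simp
    · congr 1
      · simp
      · field_simp; ring
  · have := isCurve_arc (Real.sqrt (Real.pi * |t|)) 0 (2 * Real.pi) (by simp [hpi.ne'])
    have e : Real.sqrt (Real.pi * |t|) ^ 2 + 0 ^ 2 = Real.pi * |t| := by
      rw [Real.sq_sqrt (by positivity)]; ring
    rw [e, Real.sin_two_pi, Real.cos_two_pi, abs_of_pos h] at this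
    rw [abs_of_pos h]
    convert this using 2
    · simp
    · congr 1
      · simp
      · field_simp; ring

lemma exists_phi {R T : ℝ} (hR : 0 < R) (hT : 0 < T) :
    ∃ φ, 0 < φ ∧ φ < Real.pi ∧
      R * (φ - Real.sin φ * Real.cos φ) = T * Real.sin φ ^ 2 := by
  set F : ℝ → ℝ := fun φ => T * Real.sin φ ^ 2 - R * (φ - Real.sin φ * Real.cos φ) with hF
  set φ₀ := Real.arctan (T / (2 * R)) with hφ₀
  have h0 : 0 < φ₀ := Real.arctan_pos.2 (by positivity)
  have h1 : φ₀ < Real.pi / 2 := Real.arctan_lt_pi_div_two _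
  have hc : 0 < Real.cos φ₀ := Real.cos_pos_of_mem_Ioo ⟨by linarith, h1⟩
  have hs : 0 < Real.sin φ₀ := Real.sin_pos_of_pos_of_lt_pi h0 (by linarith)
  have ht : Real.tan φ₀ = T / (2 * R) := Real.tan_arctan _
  have h2 : φ₀ < Real.tan φ₀ := Real.lt_tan h0 h1
  have hsc : Real.sin φ₀ = T / (2 * R) * Real.cos φ₀ := by
    rw [← ht, Real.tan_eq_sin_div_cos]; field_simp
  have hF0 : 0 ≤ F φ₀ := by
    simp only [hF]
    have e1 : R * (φ₀ - Real.sin φ₀ * Real.cos φ₀) ≤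
        R * (T / (2 * R) - Real.sin φ₀ * Real.cos φ₀) := by
      rw [ht] at h2; gcongr
    have e2 : R * (T / (2 * R) - Real.sin φ₀ * Real.cos φ₀) = T / 2 * Real.sin φ₀ ^ 2 := by
      have e3 : T / (2 * R) - Real.sin φ₀ * Real.cos φ₀ = T / (2 * R) * Real.sin φ₀ ^ 2 := by
        rw [Real.sin_sq]
        linear_combination (-Real.cos φ₀) * hsc
      rw [e3]; field_simp
    nlinarith [sq_nonneg (Real.sin φ₀)]
  have hFpi : F Real.pi ≤ 0 := by
    simp [hF]; positivity
  have hcont : ContinuousOn F (Set.Icc φ₀ Real.pi) := by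
    apply Continuous.continuousOn; simp only [hF]; fun_prop
  obtain ⟨φ, hφ, hz⟩ := intermediate_value_Icc' (by linarith) hcont ⟨hFpi, hF0⟩
  refine ⟨φ, by linarith [hφ.1], lt_of_le_of_ne hφ.2 ?_, ?_⟩
  · rintro rfl
    simp [hF, Real.pi_pos.ne', hR.ne'] at hz
  · simp only [hF] at hz; linarith

lemma isCurve_gen {p q t : ℝ} (hR : 0 < p ^ 2 + q ^ 2) (ht : t ≠ 0) :
    ∃ φ, 0 < φ ∧ φ < Real.pi ∧
      (p ^ 2 + q ^ 2) * (φ - Real.sin φ * Real.cos φ) = |t| * Real.sin φ ^ 2 ∧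
      IsCurve HO (p, q, t) (Real.sqrt ((φ / Real.sin φ) ^ 2 * (p ^ 2 + q ^ 2))) := by
  obtain ⟨φ, h0, hpi, h⟩ := exists_phi hR (abs_pos.2 ht)
  refine ⟨φ, h0, hpi, h, ?_⟩
  have hs := Real.sin_pos_of_pos_of_lt_pi h0 hpi
  rcases lt_or_gt_of_ne ht with h' | h'
  · have := isCurve_phi (p := p) (q := q) (t := t) (φ := -φ) (by simpa using h0.ne')
      (by simpa using hs.ne') (by
        rw [abs_of_neg h'] at h
        rw [Real.sin_neg, Real.cos_neg]
        linear_combination -h)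
    rwa [Real.sin_neg, neg_div_neg_eq] at this
  · rw [abs_of_pos h'] at h
    exact isCurve_phi h0.ne' hs.ne' h

lemma exists_curve (Q : H) : ∃ L, IsCurve HO Q L := by
  obtain ⟨p, q, t⟩ := Q
  by_cases ht : t = 0
  · subst ht; exact ⟨_, isCurve_line p q⟩
  by_cases hR : 0 < p ^ 2 + q ^ 2
  · obtain ⟨φ, _, _, _, h⟩ := isCurve_gen hR ht
    exact ⟨_, h⟩
  · have hp : p = 0 := by nlinarith [sq_nonneg p, sq_nonneg q]
    have hq : q = 0 := by nlinarith [sq_nonneg p, sq_nonneg q]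
    subst hp; subst hq
    exact ⟨_, isCurve_vert ht⟩

lemma lower (p q t φ : ℝ) (h0 : 0 < φ) (hpi : φ < Real.pi) {σ : ℝ} (hσ : σ ^ 2 = 1) :
    σ * φ * t + (p ^ 2 + q ^ 2) * (φ * Real.cos φ / Real.sin φ) ≤ dH HO (p, q, t) ^ 2 := by
  set d := dH HO (p, q, t) with hd
  have hd0 : 0 ≤ d := dH_nonneg _ _
  have key : ∀ Λ, d < Λ → σ * φ * t + (p ^ 2 + q ^ 2) * (φ * Real.cos φ / Real.sin φ) ≤ Λ ^ 2 := by
    intro Λ hΛ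
    rw [hd, dH_eq] at hΛ
    obtain ⟨L, hL, hlt⟩ := exists_lt_of_csInf_lt (exists_curve (p, q, t)) hΛ
    exact lower_curve hL h0 hpi hσ hlt
  have hc : Filter.Tendsto (fun Λ : ℝ => Λ ^ 2) (nhdsWithin d (Set.Ioi d)) (nhds (d ^ 2)) :=
    ((continuous_pow 2).tendsto d).mono_left nhdsWithin_le_nhds
  refine ge_of_tendsto hc ?_
  filter_upwards [self_mem_nhdsWithin] with Λ hΛ using key Λ hΛ

lemma lower_abs (p q t φ : ℝ) (h0 : 0 < φ) (hpi : φ < Real.pi) :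
    φ * |t| + (p ^ 2 + q ^ 2) * (φ * Real.cos φ / Real.sin φ) ≤ dH HO (p, q, t) ^ 2 := by
  rcases le_total 0 t with h | h
  · have := lower p q t φ h0 hpi (σ := 1) (by norm_num)
    rw [abs_of_nonneg h]; linarith
  · have := lower p q t φ h0 hpi (σ := -1) (by norm_num)
    rw [abs_of_nonpos h]; linarith

lemma lower_zero (p q t : ℝ) : p ^ 2 + q ^ 2 ≤ dH HO (p, q, t) ^ 2 := by
  have hc : Filter.Tendsto (fun φ : ℝ => (p ^ 2 + q ^ 2) * Real.cos φ)
      (nhdsWithin 0 (Set.Ioi 0)) (nhds (p ^ 2 + q ^ 2)) := by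
    have : Continuous (fun φ : ℝ => (p ^ 2 + q ^ 2) * Real.cos φ) := by fun_prop
    have := (this.tendsto 0).mono_left (nhdsWithin_le_nhds (s := Set.Ioi 0))
    simpa using this
  refine le_of_tendsto hc ?_
  filter_upwards [Ioo_mem_nhdsGT (show (0:ℝ) < Real.pi / 2 by positivity)] with φ hφ
  have hs : 0 < Real.sin φ := Real.sin_pos_of_pos_of_lt_pi hφ.1 (by linarith [hφ.2, Real.pi_pos])
  have hcs : 0 < Real.cos φ := Real.cos_pos_of_mem_Ioo ⟨by linarith [hφ.1, Real.pi_pos], hφ.2⟩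
  have h := lower_abs p q t φ hφ.1 (by linarith [hφ.2, Real.pi_pos])
  have h2 : Real.cos φ ≤ φ * Real.cos φ / Real.sin φ := by
    rw [le_div_iff₀ hs]
    nlinarith [Real.sin_lt hφ.1]
  have h3 : 0 ≤ φ * |t| := mul_nonneg hφ.1.le (abs_nonneg t)
  have h4 : (p ^ 2 + q ^ 2) * Real.cos φ ≤ (p ^ 2 + q ^ 2) * (φ * Real.cos φ / Real.sin φ) := by
    gcongr
  linarith

lemma upper_vert (t : ℝ) : dH HO (0, 0, t) ^ 2 ≤ Real.pi * |t| := by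
  by_cases ht : t = 0
  · subst ht
    have := dH_le (isCurve_line 0 0)
    have h0 := dH_nonneg HO (0, 0, 0)
    simp at this
    have : dH HO (0, 0, 0) = 0 := le_antisymm this h0
    simp [this]
  · have := dH_le (isCurve_vert ht)
    have h0 := dH_nonneg HO (0, 0, t)
    calc _ ≤ Real.sqrt (Real.pi * |t|) ^ 2 := by gcongr
      _ = _ := Real.sq_sqrt (by positivity)

lemma upper_line (p q : ℝ) : dH HO (p, q, 0) ^ 2 ≤ p ^ 2 + q ^ 2 := by
  have := dH_le (isCurve_line p q)
  have h0 := dH_nonneg HO (p, q, 0)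
  calc _ ≤ Real.sqrt (p ^ 2 + q ^ 2) ^ 2 := by gcongr
    _ = _ := Real.sq_sqrt (by positivity)

lemma upper_gen {p q t : ℝ} (hR : 0 < p ^ 2 + q ^ 2) (ht : t ≠ 0) :
    ∃ φ, 0 < φ ∧ φ < Real.pi ∧
      dH HO (p, q, t) ^ 2 ≤ (φ / Real.sin φ) ^ 2 * (p ^ 2 + q ^ 2) ∧
      (φ / Real.sin φ) ^ 2 * (p ^ 2 + q ^ 2) =
        φ * |t| + (p ^ 2 + q ^ 2) * (φ * Real.cos φ / Real.sin φ) := by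
  obtain ⟨φ, h0, hpi, h, hc⟩ := isCurve_gen hR ht
  have hs := Real.sin_pos_of_pos_of_lt_pi h0 hpi
  refine ⟨φ, h0, hpi, ?_, ?_⟩
  · have := dH_le hc
    have h0 := dH_nonneg HO (p, q, t)
    calc _ ≤ Real.sqrt _ ^ 2 := pow_le_pow_left₀ h0 this 2
      _ = _ := Real.sq_sqrt (by positivity)
  · field_simp
    linear_combination h

lemma cot_le_one {φ : ℝ} (h0 : 0 < φ) (hpi : φ < Real.pi) :
    φ * Real.cos φ / Real.sin φ ≤ 1 := by
  have hs := Real.sin_pos_of_pos_of_lt_pi h0 hpi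
  rw [div_le_one hs]
  rcases lt_or_ge φ (Real.pi / 2) with h | h
  · have hcs : 0 < Real.cos φ := Real.cos_pos_of_mem_Ioo ⟨by linarith [Real.pi_pos], h⟩
    have := (Real.lt_tan h0 h).le
    rwa [Real.tan_eq_sin_div_cos, le_div_iff₀ hcs] at this
  · have := Real.cos_nonpos_of_pi_div_two_le_of_le h (by linarith)
    nlinarith

lemma upper_crude (p q t : ℝ) : dH HO (p, q, t) ^ 2 ≤ p ^ 2 + q ^ 2 + Real.pi * |t| := by
  by_cases ht : t = 0
  · subst ht
    simpa using upper_line p q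
  by_cases hR : 0 < p ^ 2 + q ^ 2
  · obtain ⟨φ, h0, hpi, h1, h2⟩ := upper_gen hR ht
    have h3 := cot_le_one h0 hpi
    have h4 : φ * |t| ≤ Real.pi * |t| := by gcongr
    have h5 : (p ^ 2 + q ^ 2) * (φ * Real.cos φ / Real.sin φ) ≤ (p ^ 2 + q ^ 2) * 1 := by gcongr
    linarith
  · have hp : p = 0 := by nlinarith [sq_nonneg p, sq_nonneg q]
    have hq : q = 0 := by nlinarith [sq_nonneg p, sq_nonneg q]
    subst hp; subst hq
    simpa using upper_vert t

lemma dist_le_of_eq {p q t p' q' t' : ℝ} (hR : 0 < p ^ 2 + q ^ 2) (ht : t ≠ 0)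
    (h1 : p ^ 2 + q ^ 2 = p' ^ 2 + q' ^ 2) (h2 : |t| = |t'|) :
    dH HO (p, q, t) ≤ dH HO (p', q', t') := by
  obtain ⟨φ, h0, hpi, h3, h4⟩ := upper_gen hR ht
  have h5 := lower_abs p' q' t' φ h0 hpi
  rw [← h1, ← h2] at h5
  exact abs_le_of_sq_le_sq' (by linarith) (dH_nonneg _ _) |>.2

lemma dH_coord (x y s p q t : ℝ) : dH (x, y, s) (p, q, t) =
    dH HO (p - x, q - y, t - s + 2 * (x * q - p * y)) := by
  rw [dH_left]
  congr 1
  ext <;> simp only [Hmul, Hinv] <;> ring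

lemma mid_lemma {p q t : ℝ} (hR : 0 < p ^ 2 + q ^ 2) :
    ∃ β m₁ m₂ : ℝ, 0 ≤ β ∧ 4 * (p ^ 2 + q ^ 2) ≤ β ^ 2 * dH HO (p, q, t) ^ 2 ∧
      ∀ x y s : ℝ, dH HO (p, q, t) ^ 2 + 2 * β * ((x - m₁) ^ 2 + (y - m₂) ^ 2) ≤
        2 * (dH HO (x, y, s) ^ 2 + dH (x, y, s) (p, q, t) ^ 2) := by
  by_cases ht : t = 0
  · subst ht
    have h1 := upper_line p q
    have h2 := lower_zero p q 0
    refine ⟨2, p / 2, q / 2, by norm_num, by linarith, fun x y s => ?_⟩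
    rw [dH_coord x y s p q _]
    have h3 := lower_zero x y s
    have h4 := lower_zero (p - x) (q - y) (0 - s + 2 * (x * q - p * y))
    nlinarith
  · obtain ⟨φ, h0, hpi, h1, h2⟩ := upper_gen hR ht
    have hlow := lower_abs p q t φ h0 hpi
    rw [← h2] at hlow
    have hsφ := Real.sin_pos_of_pos_of_lt_pi h0 hpi
    obtain ⟨ψ, rfl⟩ : ∃ ψ, φ = 2 * ψ := ⟨φ / 2, by ring⟩
    have hψ0 : 0 < ψ := by linarith
    have hψ1 : ψ < Real.pi := by linarith
    have hS : 0 < Real.sin ψ := Real.sin_pos_of_pos_of_lt_pi hψ0 hψ1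
    have hC : 0 < Real.cos ψ := Real.cos_pos_of_mem_Ioo ⟨by linarith, by linarith⟩
    have hSψ : Real.sin ψ ≤ ψ := Real.sin_le hψ0.le
    have hSC := Real.sin_sq_add_cos_sq ψ
    obtain ⟨σ, hσ, hσt⟩ : ∃ σ : ℝ, σ ^ 2 = 1 ∧ σ * t = |t| := by
      rcases le_total 0 t with h | h
      · exact ⟨1, by norm_num, by rw [abs_of_nonneg h]; ring⟩
      · exact ⟨-1, by norm_num, by rw [abs_of_nonpos h]; ring⟩
    rw [Real.sin_two_mul] at h1 h2 hlow
    have hcos : Real.cos (2 * ψ) = Real.cos ψ ^ 2 - Real.sin ψ ^ 2 := Real.cos_two_mul' ψ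
    rw [hcos] at h2
    have lw := fun p q t : ℝ => lower p q t ψ hψ0 hψ1 hσ
    generalize Real.sin ψ = S at *
    generalize Real.cos ψ = C at *
    refine ⟨2 * ψ * C / S, (p - σ * (S / C) * q) / 2, (q + σ * (S / C) * p) / 2, by positivity,
      ?_, ?_⟩
    · have e : (2 * ψ * C / S) ^ 2 * ((2 * ψ / (2 * S * C)) ^ 2 * (p ^ 2 + q ^ 2)) =
        4 * (p ^ 2 + q ^ 2) * (ψ / S) ^ 4 := by field_simp; ring
      have e1 : 1 ≤ (ψ / S) ^ 4 := one_le_pow₀ ((one_le_div hS).2 hSψ)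
      calc 4 * (p ^ 2 + q ^ 2) ≤ 4 * (p ^ 2 + q ^ 2) * (ψ / S) ^ 4 :=
            le_mul_of_one_le_right (by positivity) e1
        _ ≤ _ := by rw [← e]; gcongr
    · intro x y s
      rw [dH_coord x y s p q _]
      have l1 := lw x y s
      have l2 := lw (p - x) (q - y) (t - s + 2 * (x * q - p * y))
      have hid : (2 * ψ / (2 * S * C)) ^ 2 * (p ^ 2 + q ^ 2) + 2 * (2 * ψ * C / S) *
          ((x - (p - σ * (S / C) * q) / 2) ^ 2 + (y - (q + σ * (S / C) * p) / 2) ^ 2) =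
          2 * ((σ * ψ * s + (x ^ 2 + y ^ 2) * (ψ * C / S)) +
            (σ * ψ * (t - s + 2 * (x * q - p * y)) +
              ((p - x) ^ 2 + (q - y) ^ 2) * (ψ * C / S))) := by
        rw [h2, ← hσt]
        field_simp
        linear_combination (S ^ 2 * (p ^ 2 + q ^ 2)) * hσ
      linarith


lemma lower_vert (t : ℝ) : Real.pi * |t| ≤ dH HO (0, 0, t) ^ 2 := by
  by_contra hcon
  push Not at hcon
  set d := dH HO (0, 0, t) ^ 2 with hd
  have hd0 : 0 ≤ d := by positivity
  have hpi := Real.pi_pos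
  have ht : 0 < |t| := by
    by_contra h
    have : |t| = 0 := le_antisymm (not_lt.1 h) (abs_nonneg t)
    rw [this] at hcon
    linarith
  have hq : d / |t| < Real.pi := (div_lt_iff₀ ht).2 hcon
  have hq0 : 0 ≤ d / |t| := by positivity
  have h := lower_abs 0 0 t ((d / |t| + Real.pi) / 2) (by linarith) (by linarith)
  rw [← hd] at h
  have e : d / |t| * |t| = d := by field_simp
  nlinarith

lemma core_sign {A B C S : ℝ} (hS : 0 < S) (a1 : 0.88 * S ≤ |A|) (a2 : |A| ≤ 1.543 * S)
    (b1 : 0.88 * S ≤ |B|) (b2 : |B| ≤ 1.543 * S)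
    (c1 : 0.88 * S ≤ |C|) (c2 : |C| ≤ 1.543 * S) (h : |A + B + C| ≤ 0.126 * S) : False := by
  have h' := abs_le.1 h
  obtain ⟨h1, h2⟩ := h'
  rcases abs_cases A with ⟨ea, _⟩ | ⟨ea, _⟩ <;> rcases abs_cases B with ⟨eb, _⟩ | ⟨eb, _⟩ <;>
    rcases abs_cases C with ⟨ec, _⟩ | ⟨ec, _⟩ <;> rw [ea] at a1 a2 <;> rw [eb] at b1 b2 <;>
    rw [ec] at c1 c2 <;> linarith

lemma one_delta {x y t S : ℝ} (h : x ^ 2 + y ^ 2 ≤ 0.02 * S)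
    (l : 0.9 * S ≤ dH HO (x, y, t) ^ 2) (u : dH HO (x, y, t) ^ 2 ≤ 1.11 * S) :
    0.88 * S ≤ |Real.pi * t| ∧ |Real.pi * t| ≤ 1.543 * S := by
  have hp := Real.pi_pos
  have hp2 := Real.pi_lt_d2
  have h1 := upper_crude x y t
  have h2 := lower_abs x y t (Real.pi - Real.pi / 4) (by linarith) (by linarith)
  rw [Real.cos_pi_sub, Real.sin_pi_sub, Real.cos_pi_div_four, Real.sin_pi_div_four] at h2
  have e : (Real.pi - Real.pi / 4) * -(Real.sqrt 2 / 2) / (Real.sqrt 2 / 2) =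
      - (3 / 4 * Real.pi) := by
    field_simp; ring
  rw [e] at h2
  have e2 : |Real.pi * t| = Real.pi * |t| := by rw [abs_mul, abs_of_pos hp]
  rw [e2]
  have hx : 0 ≤ x ^ 2 + y ^ 2 := by positivity
  refine ⟨by linarith, ?_⟩
  nlinarith

lemma three_points {x₀ y₀ t₀ x₁ y₁ t₁ x₂ y₂ t₂ S : ℝ} (hS : 0 < S)
    (h01 : (x₁ - x₀) ^ 2 + (y₁ - y₀) ^ 2 ≤ 0.02 * S)
    (h12 : (x₂ - x₁) ^ 2 + (y₂ - y₁) ^ 2 ≤ 0.02 * S)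
    (h20 : (x₀ - x₂) ^ 2 + (y₀ - y₂) ^ 2 ≤ 0.02 * S)
    (l01 : 0.9 * S ≤ dH (x₀, y₀, t₀) (x₁, y₁, t₁) ^ 2)
    (u01 : dH (x₀, y₀, t₀) (x₁, y₁, t₁) ^ 2 ≤ 1.11 * S)
    (l12 : 0.9 * S ≤ dH (x₁, y₁, t₁) (x₂, y₂, t₂) ^ 2)
    (u12 : dH (x₁, y₁, t₁) (x₂, y₂, t₂) ^ 2 ≤ 1.11 * S)
    (l20 : 0.9 * S ≤ dH (x₂, y₂, t₂) (x₀, y₀, t₀) ^ 2)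
    (u20 : dH (x₂, y₂, t₂) (x₀, y₀, t₀) ^ 2 ≤ 1.11 * S) : False := by
  rw [dH_coord] at l01 u01 l12 u12 l20 u20
  obtain ⟨a1, a2⟩ := one_delta h01 l01 u01
  obtain ⟨b1, b2⟩ := one_delta h12 l12 u12
  obtain ⟨c1, c2⟩ := one_delta h20 l20 u20
  refine core_sign hS a1 a2 b1 b2 c1 c2 ?_
  have hp := Real.pi_pos
  have hp2 := Real.pi_lt_d2
  have e : Real.pi * (t₁ - t₀ + 2 * (x₀ * y₁ - x₁ * y₀)) +
      Real.pi * (t₂ - t₁ + 2 * (x₁ * y₂ - x₂ * y₁)) +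
      Real.pi * (t₀ - t₂ + 2 * (x₂ * y₀ - x₀ * y₂)) =
      Real.pi * (2 * ((x₁ - x₀) * (y₂ - y₁) - (x₂ - x₁) * (y₁ - y₀))) := by ring
  rw [e, abs_mul, abs_of_pos hp]
  have h : |2 * ((x₁ - x₀) * (y₂ - y₁) - (x₂ - x₁) * (y₁ - y₀))| ≤ 0.04 * S := by
    rw [abs_le]
    constructor
    · nlinarith [sq_nonneg ((x₁ - x₀) + (y₂ - y₁)), sq_nonneg ((x₂ - x₁) - (y₁ - y₀))]
    · nlinarith [sq_nonneg ((x₁ - x₀) - (y₂ - y₁)), sq_nonneg ((x₂ - x₁) + (y₁ - y₀))]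
  nlinarith

lemma half_dist {p q t : ℝ} (ht : t ≠ 0) (h : (p ^ 2 + q ^ 2) * Real.pi = 2 * |t|) :
    dH HO (p, q, t) ^ 2 ≤ Real.pi * |t| / 2 := by
  have hp := Real.pi_pos
  have key : ∃ φ : ℝ, φ ≠ 0 ∧ Real.sin φ ^ 2 = 1 ∧ Real.cos φ = 0 ∧ φ ^ 2 = Real.pi ^ 2 / 4 ∧
      (p ^ 2 + q ^ 2) * φ = t := by
    rcases lt_or_gt_of_ne ht with h0 | h0
    · refine ⟨-(Real.pi / 2), by linarith, ?_, ?_, by ring, ?_⟩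
      · rw [Real.sin_neg, Real.sin_pi_div_two]; norm_num
      · rw [Real.cos_neg, Real.cos_pi_div_two]
      · rw [abs_of_neg h0] at h; linarith
    · refine ⟨Real.pi / 2, by linarith, ?_, ?_, by ring, ?_⟩
      · rw [Real.sin_pi_div_two]; norm_num
      · rw [Real.cos_pi_div_two]
      · rw [abs_of_pos h0] at h; linarith
  obtain ⟨φ, h1, h2, h3, h4, h5⟩ := key
  have hs : Real.sin φ ≠ 0 := by
    intro h0; rw [h0] at h2; norm_num at h2
  have hc := dH_le (isCurve_phi (p := p) (q := q) (t := t) h1 hs (by rw [h3, h2]; linarith))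
  have hn := dH_nonneg HO (p, q, t)
  calc dH HO (p, q, t) ^ 2 ≤ Real.sqrt ((φ / Real.sin φ) ^ 2 * (p ^ 2 + q ^ 2)) ^ 2 := by gcongr
    _ = (φ / Real.sin φ) ^ 2 * (p ^ 2 + q ^ 2) := Real.sq_sqrt (by positivity)
    _ = Real.pi ^ 2 / 4 * (p ^ 2 + q ^ 2) := by rw [div_pow, h2, h4]; ring
    _ ≤ Real.pi * |t| / 2 := by nlinarith

lemma exists_mid {T : ℝ} (hT : T ≠ 0) : ∃ (M₀ M₁ M₂ : H) (S : ℝ), 0.3 * (Real.pi * |T|) ≤ S ∧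
    (dH HO M₀ ^ 2 ≤ Real.pi * |T| / 4 ∧ dH M₀ (0, 0, T) ^ 2 ≤ Real.pi * |T| / 4) ∧
    (dH HO M₁ ^ 2 ≤ Real.pi * |T| / 4 ∧ dH M₁ (0, 0, T) ^ 2 ≤ Real.pi * |T| / 4) ∧
    (dH HO M₂ ^ 2 ≤ Real.pi * |T| / 4 ∧ dH M₂ (0, 0, T) ^ 2 ≤ Real.pi * |T| / 4) ∧
    dH M₀ M₁ ^ 2 = S ∧ dH M₁ M₂ ^ 2 = S ∧ dH M₂ M₀ ^ 2 = S := by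
  have hp := Real.pi_pos
  have hp2 := Real.pi_lt_d2
  have hT' : 0 < |T| := abs_pos.2 hT
  obtain ⟨r, hr0, hr⟩ : ∃ r : ℝ, 0 < r ∧ r ^ 2 * Real.pi = |T| := by
    refine ⟨Real.sqrt (|T| / Real.pi), by positivity, ?_⟩
    rw [Real.sq_sqrt (by positivity)]; field_simp
  obtain ⟨w, hw0, hw⟩ : ∃ w : ℝ, 0 < w ∧ w ^ 2 = 3 :=
    ⟨Real.sqrt 3, by positivity, Real.sq_sqrt (by norm_num)⟩
  have hhalf : |T / 2| = |T| / 2 := by rw [abs_div]; norm_num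
  have dist : ∀ x y : ℝ, x ^ 2 + y ^ 2 = r ^ 2 → dH HO (x, y, T / 2) ^ 2 ≤ Real.pi * |T| / 4 ∧
      dH (x, y, T / 2) (0, 0, T) ^ 2 ≤ Real.pi * |T| / 4 := by
    intro x y hxy
    have hT2 : T / 2 ≠ 0 := by simpa using hT
    constructor
    · have := half_dist (p := x) (q := y) (t := T / 2) hT2 (by rw [hxy, hr, hhalf]; ring)
      rw [hhalf] at this; linarith
    · rw [dH_coord]
      have e : T - T / 2 + 2 * (x * 0 - 0 * y) = T / 2 := by ring
      rw [e]
      have := half_dist (p := 0 - x) (q := 0 - y) (t := T / 2) hT2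
        (by rw [hhalf, ← hr]; linear_combination Real.pi * hxy)
      rw [hhalf] at this; linarith
  have hwr : 0 < w * r ^ 2 := by positivity
  have eqd : ∀ x y s x' y' s' : ℝ, x ^ 2 + y ^ 2 = 3 * r ^ 2 → x' ^ 2 + y' ^ 2 = 3 * r ^ 2 →
      s ^ 2 = (w * r ^ 2) ^ 2 → s' ^ 2 = (w * r ^ 2) ^ 2 →
      dH HO (x, y, s) = dH HO (x', y', s') := by
    intro x y s x' y' s' h1 h2 h3 h4
    have n : ∀ s : ℝ, s ^ 2 = (w * r ^ 2) ^ 2 → s ≠ 0 := by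
      intro s h h0
      rw [h0] at h
      nlinarith [pow_pos hwr 2]
    have ab : |s| = |s'| := (sq_eq_sq_iff_abs_eq_abs s s').1 (h3.trans h4.symm)
    have hr3 : 0 < 3 * r ^ 2 := by positivity
    exact le_antisymm (dist_le_of_eq (by rw [h1]; exact hr3) (n s h3) (by rw [h1, h2]) ab)
      (dist_le_of_eq (by rw [h2]; exact hr3) (n s' h4) (by rw [h1, h2]) ab.symm)
  refine ⟨(r, 0, T / 2), (-(r / 2), w * r / 2, T / 2), (-(r / 2), -(w * r / 2), T / 2),
    dH (r, 0, T / 2) (-(r / 2), w * r / 2, T / 2) ^ 2, ?_, dist _ _ (by ring), dist _ _ ?_,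
    dist _ _ ?_, rfl, ?_, ?_⟩
  · rw [dH_coord]
    have := lower_zero (-(r / 2) - r) (w * r / 2 - 0)
      (T / 2 - T / 2 + 2 * (r * (w * r / 2) - -(r / 2) * 0))
    have e : (-(r / 2) - r) ^ 2 + (w * r / 2 - 0) ^ 2 = 3 * r ^ 2 := by
      linear_combination (r ^ 2 / 4) * hw
    rw [e] at this
    refine le_trans ?_ this
    rw [← hr]
    have : Real.pi ^ 2 ≤ 10 := by nlinarith
    nlinarith [sq_nonneg r]
  · linear_combination (r ^ 2 / 4) * hw
  · linear_combination (r ^ 2 / 4) * hw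
  · rw [dH_coord r 0, dH_coord (-(r / 2))]
    congr 1
    apply eqd
    · linear_combination (r ^ 2) * hw
    · linear_combination (r ^ 2 / 4) * hw
    · ring
    · ring
  · rw [dH_coord r 0, dH_coord (-(r / 2))]
    congr 1
    apply eqd
    · linear_combination (r ^ 2 / 4) * hw
    · linear_combination (r ^ 2 / 4) * hw
    · ring
    · ring

lemma tri_aux {x y x' y' m₁ m₂ c e : ℝ} (u : (x - m₁) ^ 2 + (y - m₂) ^ 2 < c)
    (v : (x' - m₁) ^ 2 + (y' - m₂) ^ 2 < c) (h : 4 * c ≤ e) :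
    (x' - x) ^ 2 + (y' - y) ^ 2 ≤ e := by
  linarith [sq_nonneg ((x - m₁) + (x' - m₁)), sq_nonneg ((y - m₂) + (y' - m₂))]

lemma bilip_sq {ε : ℝ} (h0 : 0 ≤ ε) {f : H → H} (hf : IsBiLip ε f) (P Q : H) :
    dH P Q ^ 2 ≤ (1 + ε) ^ 2 * dH (f P) (f Q) ^ 2 ∧
      dH (f P) (f Q) ^ 2 ≤ (1 + ε) ^ 2 * dH P Q ^ 2 := by
  obtain ⟨h1, h2⟩ := hf P Q
  have a := dH_nonneg P Q
  have b := dH_nonneg (f P) (f Q)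
  have h1' : dH P Q ≤ (1 + ε) * dH (f P) (f Q) := by
    rwa [inv_mul_le_iff₀ (by linarith)] at h1
  constructor
  · rw [← mul_pow]; gcongr
  · rw [← mul_pow]; gcongr

set_option maxHeartbeats 2000000 in
lemma horiz_bound {ε : ℝ} (h0 : 0 ≤ ε) (h1 : ε ≤ 1 / 20) {f : H → H} (hf : IsBiLip ε f)
    (hO : f HO = HO) {T : ℝ} (hT : T ≠ 0) :
    (f (0, 0, T)).1 ^ 2 + (f (0, 0, T)).2.1 ^ 2 ≤ 10 ^ 7 * ε ^ 2 * |T| := by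
  have hp := Real.pi_pos
  have hp2 := Real.pi_lt_d2
  have hT' : 0 < |T| := abs_pos.2 hT
  obtain ⟨M₀, M₁, M₂, S, hS, ⟨a0, b0⟩, ⟨a1, b1⟩, ⟨a2, b2⟩, d01, d12, d20⟩ := exists_mid hT
  have B := bilip_sq h0 hf
  have hk : (1 + ε) ^ 2 ≤ 1 + 2.05 * ε := by nlinarith
  have hk1 : 1 ≤ (1 + ε) ^ 2 := by nlinarith
  have hD := B HO (0, 0, T)
  have hv1 := upper_vert T
  have hv2 := lower_vert T
  have A0 := (B HO M₀).2
  have A1 := (B HO M₁).2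
  have A2 := (B HO M₂).2
  have B0 := (B M₀ (0, 0, T)).2
  have B1 := (B M₁ (0, 0, T)).2
  have B2 := (B M₂ (0, 0, T)).2
  have D01 := B M₀ M₁
  have D12 := B M₁ M₂
  have D20 := B M₂ M₀
  rw [hO] at hD A0 A1 A2
  rw [d01] at D01
  rw [d12] at D12
  rw [d20] at D20
  generalize f M₀ = N0 at *
  obtain ⟨x₀, y₀, t₀⟩ := N0
  generalize f M₁ = N1 at *
  obtain ⟨x₁, y₁, t₁⟩ := N1
  generalize f M₂ = N2 at *
  obtain ⟨x₂, y₂, t₂⟩ := N2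
  generalize f (0, 0, T) = N3 at *
  obtain ⟨p, q, t⟩ := N3
  simp only
  generalize (1 + ε) ^ 2 = k at *
  set V := Real.pi * |T| with hV
  have hV0 : 0 < V := by positivity
  have hS0 : 0 < S := by linarith
  rcases (show 0 ≤ p ^ 2 + q ^ 2 by positivity).eq_or_lt with hR | hR
  · rw [← hR]; positivity
  obtain ⟨β, m₁, m₂, hβ, hβR, hm⟩ := mid_lemma (t := t) hR
  set D := dH HO (p, q, t) ^ 2 with hDD
  have hDu : D ≤ k * V := hD.2.trans (by gcongr)
  have hDl : V ≤ k * D := hv2.trans hD.1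
  have hDl2 : V - 2.05 * ε * V ≤ D := by
    have : V ≤ (1 + 2.05 * ε) * D := hDl.trans (by gcongr)
    nlinarith [mul_nonneg (mul_nonneg h0 h0) hV0.le]
  have key : ∀ x y s : ℝ, ∀ M : H, dH HO (x, y, s) ^ 2 ≤ k * dH HO M ^ 2 →
      dH HO M ^ 2 ≤ V / 4 → dH (x, y, s) (p, q, t) ^ 2 ≤ k * dH M (0, 0, T) ^ 2 →
      dH M (0, 0, T) ^ 2 ≤ V / 4 → β * ((x - m₁) ^ 2 + (y - m₂) ^ 2) ≤ 2.05 * ε * V := by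
    intro x y s M c1 c2 c3 c4
    have c := hm x y s
    have e1 : dH HO (x, y, s) ^ 2 ≤ (1 + 2.05 * ε) * (V / 4) := c1.trans (by gcongr)
    have e2 : dH (x, y, s) (p, q, t) ^ 2 ≤ (1 + 2.05 * ε) * (V / 4) := c3.trans (by gcongr)
    linarith
  have K0 := key x₀ y₀ t₀ M₀ A0 a0 B0 b0
  have K1 := key x₁ y₁ t₁ M₁ A1 a1 B1 b1
  have K2 := key x₂ y₂ t₂ M₂ A2 a2 B2 b2
  have kk : k ≤ 1.11 := by linarith
  have exj : ∃ g : ℝ, 0.0015 * V ≤ g ∧ β * g ≤ 2.05 * ε * V := by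
    by_contra hcon
    push Not at hcon
    have g0 : (x₀ - m₁) ^ 2 + (y₀ - m₂) ^ 2 < 0.0015 * V := by
      by_contra h; exact absurd K0 (not_le.2 (hcon _ (not_lt.1 h)))
    have g1 : (x₁ - m₁) ^ 2 + (y₁ - m₂) ^ 2 < 0.0015 * V := by
      by_contra h; exact absurd K1 (not_le.2 (hcon _ (not_lt.1 h)))
    have g2 : (x₂ - m₁) ^ 2 + (y₂ - m₂) ^ 2 < 0.0015 * V := by
      by_contra h; exact absurd K2 (not_le.2 (hcon _ (not_lt.1 h)))
    have tri : ∀ x y x' y' : ℝ, (x - m₁) ^ 2 + (y - m₂) ^ 2 < 0.0015 * V →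
        (x' - m₁) ^ 2 + (y' - m₂) ^ 2 < 0.0015 * V →
        (x' - x) ^ 2 + (y' - y) ^ 2 ≤ 0.02 * S := by
      intro x y x' y' u v
      exact tri_aux u v (by linarith)
    have lo : ∀ d : ℝ, 0 ≤ d → S ≤ k * d → 0.9 * S ≤ d := by
      intro d hd h
      have : k * d ≤ 1.11 * d := by gcongr
      linarith
    have hi : ∀ d : ℝ, d ≤ k * S → d ≤ 1.11 * S := by
      intro d h
      exact h.trans (by gcongr)
    exact three_points hS0 (tri _ _ _ _ g0 g1) (tri _ _ _ _ g1 g2) (tri _ _ _ _ g2 g0)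
      (lo _ (by positivity) D01.1) (hi _ D01.2) (lo _ (by positivity) D12.1) (hi _ D12.2)
      (lo _ (by positivity) D20.1) (hi _ D20.2)
  obtain ⟨g, hg1, hg2⟩ := exj
  have hβ2 : β ≤ 1400 * ε := by
    have : β * (0.0015 * V) ≤ 2.05 * ε * V := (by gcongr : β * (0.0015 * V) ≤ β * g).trans hg2
    have : β * 0.0015 ≤ 2.05 * ε := le_of_mul_le_mul_right (by linarith) hV0
    linarith
  have h5 : β ^ 2 * D ≤ (1400 * ε) ^ 2 * (1.11 * (3.15 * |T|)) := by
    have : D ≤ 1.11 * (3.15 * |T|) := by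
      calc D ≤ k * V := hDu
        _ ≤ 1.11 * V := by gcongr
        _ ≤ 1.11 * (3.15 * |T|) := by rw [hV]; gcongr
    gcongr
  have : 0 ≤ ε ^ 2 * |T| := by positivity
  linarith

lemma vert_bound {ε : ℝ} (h0 : 0 ≤ ε) (h1 : ε ≤ 1 / 20) {f : H → H} (hf : IsBiLip ε f)
    (hO : f HO = HO) {T : ℝ} (hT : T ≠ 0) :
    abs (|T| - |(f (0, 0, T)).2.2|) ≤ 10 ^ 8 * ε * |T| := by
  have hp := Real.pi_pos
  have hp2 := Real.pi_lt_d2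
  have hp3 := Real.pi_gt_three
  have hT' : 0 < |T| := abs_pos.2 hT
  have hR := horiz_bound h0 h1 hf hO hT
  have hD := bilip_sq h0 hf HO (0, 0, T)
  have hk : (1 + ε) ^ 2 ≤ 1 + 2.05 * ε := by nlinarith
  have hv1 := upper_vert T
  have hv2 := lower_vert T
  rw [hO] at hD
  generalize f (0, 0, T) = N3 at *
  obtain ⟨p, q, t⟩ := N3
  simp only at hR ⊢
  generalize (1 + ε) ^ 2 = k at *
  set D := dH HO (p, q, t) ^ 2 with hDD
  have hD0 : 0 ≤ D := by positivity
  have hDu : D ≤ (1 + 2.05 * ε) * (Real.pi * |T|) := hD.2.trans (by gcongr)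
  have hDl : Real.pi * |T| ≤ (1 + 2.05 * ε) * D := hv2.trans (hD.1.trans (by gcongr))
  have hDl2 : Real.pi * |T| - 2.05 * ε * (Real.pi * |T|) ≤ D := by
    have : 0 ≤ ε * ε * (Real.pi * |T|) := by positivity
    nlinarith
  have hc := upper_crude p q t
  rw [← hDD] at hc
  have heT : 0 ≤ ε * |T| := by positivity
  have hR' : p ^ 2 + q ^ 2 ≤ 10 ^ 7 * (ε * |T|) := by
    have : ε ^ 2 * |T| ≤ ε * |T| := by nlinarith
    linarith
  rw [abs_le]
  constructor
  · rcases h0.eq_or_lt with he | he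
    · have hz : p ^ 2 + q ^ 2 ≤ 0 := by rw [← he] at hR; simpa using hR
      have hp0 : p = 0 := by nlinarith
      have hq0 : q = 0 := by nlinarith
      have := lower_vert t
      rw [hp0, hq0] at hDD
      rw [← hDD] at this
      rw [← he] at hDu ⊢
      nlinarith
    · have l1 := lower_abs p q t (Real.pi / 2) (by linarith) (by linarith)
      rw [Real.cos_pi_div_two, ← hDD, mul_zero, zero_div, mul_zero, add_zero] at l1
      have l2 := lower_abs p q t (Real.pi - ε) (by linarith) (by linarith)
      rw [Real.cos_pi_sub, Real.sin_pi_sub, ← hDD] at l2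
      have hs := Real.sin_pos_of_pos_of_lt_pi he (by linarith)
      have hcs := cot_le_one he (by linarith)
      have hcot : Real.cos ε / Real.sin ε ≤ 1 / ε := by
        rw [le_div_iff₀ he]; linarith [show Real.cos ε / Real.sin ε * ε =
          ε * Real.cos ε / Real.sin ε by ring]
      have hcc : 0 ≤ Real.cos ε := Real.cos_nonneg_of_mem_Icc ⟨by linarith, by linarith⟩
      have e : (p ^ 2 + q ^ 2) * ((Real.pi - ε) * -Real.cos ε / Real.sin ε) =
        -((p ^ 2 + q ^ 2) * ((Real.pi - ε) * (Real.cos ε / Real.sin ε))) := by ring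
      rw [e] at l2
      have b1 : (p ^ 2 + q ^ 2) * ((Real.pi - ε) * (Real.cos ε / Real.sin ε)) ≤
          10 ^ 7 * ε ^ 2 * |T| * (Real.pi * (1 / ε)) := by
        have : 0 ≤ Real.cos ε / Real.sin ε := by positivity
        have h3 : 0 ≤ Real.pi - ε := by linarith
        have h4 : Real.pi - ε ≤ Real.pi := by linarith
        have h5 : (Real.pi - ε) * (Real.cos ε / Real.sin ε) ≤ Real.pi * (1 / ε) :=
          mul_le_mul h4 hcot this hp.le
        exact mul_le_mul hR h5 (mul_nonneg h3 this) (by positivity)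
      have b2 : 10 ^ 7 * ε ^ 2 * |T| * (Real.pi * (1 / ε)) = 10 ^ 7 * (ε * |T|) * Real.pi := by
        field_simp
      have hτ : |t| ≤ 3 * |T| := by
        have : Real.pi * |t| ≤ Real.pi * (3 * |T|) := by
          have : ε * (Real.pi * |T|) ≤ 1 / 20 * (Real.pi * |T|) := by gcongr
          linarith
        exact le_of_mul_le_mul_left this hp
      have b3 : ε * |t| ≤ ε * (3 * |T|) := by gcongr
      have fin : Real.pi * |t| ≤ Real.pi * (|T| + 10 ^ 8 * ε * |T|) := by
        have e0 : 3 * (ε * |T|) ≤ Real.pi * (ε * |T|) := by gcongr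
        rw [b2] at b1
        linarith
      have := le_of_mul_le_mul_left fin hp
      linarith
  · have fin : Real.pi * |T| ≤ Real.pi * (|t| + 10 ^ 8 * ε * |T|) := by
      have e0 : 3 * (ε * |T|) ≤ Real.pi * (ε * |T|) := by gcongr
      linarith
    have := le_of_mul_le_mul_left fin hp
    linarith

/-- Theorem on the image of points of the `t`-axis.
There are `ε₀ > 0` and `C > 0` such that if `f = (ζ; τ)` is `(1+ε)`-biLipschitz
with `ε < ε₀` and `f(O) = O`, then for all `t ∈ ℝ`:
`|ζ(0,0,t)| ≤ C ε^{1/16} |t|^{1/2}` and `||t| − |τ(0,0,t)|| ≤ C ε^{1/16} |t|`. -/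
theorem statement17 :
    ∃ ε₀ > (0:ℝ), ∃ C > (0:ℝ),
      ∀ ε : ℝ, 0 ≤ ε → ε < ε₀ →
      ∀ f : H → H, IsBiLip ε f → f HO = HO →
      ∀ t : ℝ,
        Real.sqrt ((f (0, 0, t)).1 ^ 2 + (f (0, 0, t)).2.1 ^ 2)
            ≤ C * ε ^ ((1:ℝ)/16) * Real.sqrt |t| ∧
        abs (|t| - |(f (0, 0, t)).2.2|) ≤ C * ε ^ ((1:ℝ)/16) * |t| := by

  refine ⟨1 / 20, by norm_num, 10 ^ 8, by norm_num, ?_⟩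
  intro ε h0 h1 f hf hO T
  have hε : ε ≤ ε ^ ((1:ℝ)/16) := by
    rcases h0.eq_or_lt with h | h
    · rw [← h]; positivity
    · have := Real.rpow_le_rpow_of_exponent_ge h (by linarith) (show (1:ℝ)/16 ≤ 1 by norm_num)
      rwa [Real.rpow_one] at this
  by_cases hT : T = 0
  · subst hT
    have : f (0, 0, 0) = (0, 0, 0) := hO
    rw [this]
    simp
  · have a := horiz_bound h0 h1.le hf hO hT
    have b := vert_bound h0 h1.le hf hO hT
    constructor
    · calc _ ≤ Real.sqrt ((10 ^ 8 * ε) ^ 2 * |T|) := by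
            apply Real.sqrt_le_sqrt
            refine a.trans ?_
            have : 0 ≤ ε ^ 2 * |T| := by positivity
            nlinarith
        _ = 10 ^ 8 * ε * Real.sqrt |T| := by
            rw [Real.sqrt_mul (by positivity), Real.sqrt_sq (by positivity)]
        _ ≤ _ := by gcongr
    · refine b.trans ?_
      gcongr
end
end
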